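/- Let H be a group DAG on a grouping W of a finite node set N (so N is the union of the groups). Suppose that either (a) some group in W has size at least 3, or (b) the maximum group size is 2 and two groups of size 2 are adjacent in H. Then there exists a distribution p on N (with binary state spaces) such that p implies the same groupwise conditional independencies as H given W (i.e., p is groupwise faithful to H given W) and p is not faithful to any DAG on N. -/

import Mathlib

open scoped Classical

namespace GroupBN

variable {V : Type*} {I : Type*}

/-- `u` and `v` are adjacent in the digraph with arc relation `A`. -/
def Adj (A : V → V → Prop) (u v : V) : Prop := A u v ∨ A v u

/-- `A` is the arc relation of a DAG: there are no directed cycles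
(in particular `A` is irreflexive). -/
def IsDAG (A : V → V → Prop) : Prop := ∀ v : V, ¬ Relation.TransGen A v v

/-- `u` is an ancestor of `v`: there is a nonempty directed path from `u` to `v`. -/
def Ancestor (A : V → V → Prop) (u v : V) : Prop := Relation.TransGen A u v

/-- `u` and `v` are d-connected given `Z`: there is a path (an injective sequence of
pairwise adjacent consecutive nodes) from `u` to `v` such that every head-to-head
interior node is in `Z` or has a descendant in `Z`, and no other interior node is
in `Z`. -/
def DConn (A : V → V → Prop) (Z : Set V) (u v : V) : Prop :=
  ∃ (n : ℕ) (pth : Fin (n + 2) → V),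
    Function.Injective pth ∧
    pth 0 = u ∧ pth (Fin.last (n + 1)) = v ∧
    (∀ (k : ℕ) (h : k + 1 < n + 2),
      Adj A (pth ⟨k, Nat.lt_of_succ_lt h⟩) (pth ⟨k + 1, h⟩)) ∧
    (∀ (k : ℕ) (h : k + 2 < n + 2),
      (A (pth ⟨k, by omega⟩) (pth ⟨k + 1, by omega⟩) ∧
         A (pth ⟨k + 2, h⟩) (pth ⟨k + 1, by omega⟩) →
        (pth ⟨k + 1, by omega⟩ ∈ Z ∨ ∃ d ∈ Z, Ancestor A (pth ⟨k + 1, by omega⟩) d)) ∧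
      (¬ (A (pth ⟨k, by omega⟩) (pth ⟨k + 1, by omega⟩) ∧
            A (pth ⟨k + 2, h⟩) (pth ⟨k + 1, by omega⟩)) →
        pth ⟨k + 1, by omega⟩ ∉ Z))

/-- `u` and `v` are d-separated by `Z`. -/
def DSep (A : V → V → Prop) (Z : Set V) (u v : V) : Prop := ¬ DConn A Z u v

/-- The node sets `X` and `Y` are d-separated by `Z`. -/
def DSepSet (A : V → V → Prop) (Z X Y : Set V) : Prop :=
  ∀ x ∈ X, ∀ y ∈ Y, DSep A Z x y

variable {S : V → Type*}

/-- `p` is a probability mass function on the joint state space. -/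
def IsDist [Fintype V] [DecidableEq V] [∀ v, Fintype (S v)]
    (p : (∀ v, S v) → ℝ) : Prop :=
  (∀ f, 0 ≤ p f) ∧ ∑ f, p f = 1

/-- Marginal probability, under `p`, of the event that the variables in `X` take
the values prescribed by the assignment `a`. -/
noncomputable def margin [Fintype V] [DecidableEq V] [∀ v, Fintype (S v)]
    (p : (∀ v, S v) → ℝ) (X : Set V) (a : ∀ v, S v) : ℝ :=
  ∑ f : ∀ v, S v, if ∀ v ∈ X, f v = a v then p f else 0

/-- Conditional independence `X ⊥ Y | Z` in `p`, in cross-multiplied form: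
for every assignment whose `Z`-part has positive probability,
`P(X,Y,Z) · P(Z) = P(X,Z) · P(Y,Z)`. -/
def CondIndep [Fintype V] [DecidableEq V] [∀ v, Fintype (S v)]
    (p : (∀ v, S v) → ℝ) (X Y Z : Set V) : Prop :=
  ∀ a : ∀ v, S v, 0 < margin p Z a →
    margin p (X ∪ Y ∪ Z) a * margin p Z a = margin p (X ∪ Z) a * margin p (Y ∪ Z) a

/-- `p` is faithful to the DAG `A`: conditional independence coincides with
d-separation for all pairwise disjoint `X`, `Y`, `Z` with `X`, `Y` nonempty. -/
def Faithful [Fintype V] [DecidableEq V] [∀ v, Fintype (S v)]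
    (p : (∀ v, S v) → ℝ) (A : V → V → Prop) : Prop :=
  ∀ X Y Z : Set V, X.Nonempty → Y.Nonempty →
    Disjoint X Y → Disjoint X Z → Disjoint Y Z →
    (CondIndep p X Y Z ↔ DSepSet A Z X Y)

/-- `p` is groupwise faithful to the group DAG `H` given the grouping whose groups
are the fibers of the surjection `π`. -/
def GroupwiseFaithful [Fintype V] [DecidableEq V] [∀ v, Fintype (S v)]
    (p : (∀ v, S v) → ℝ) (π : V → I) (H : I → I → Prop) : Prop :=
  ∀ i j : I, i ≠ j → ∀ T : Set I, i ∉ T → j ∉ T →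
    (CondIndep p (π ⁻¹' {i}) (π ⁻¹' {j}) (π ⁻¹' T) ↔ DSep H T i j)

/-- The variable DAG `A` is groupwise Markov equivalent to the group DAG `H`
given the grouping whose groups are the fibers of the surjection `π`. -/
def GroupwiseMarkovEquiv (A : V → V → Prop) (π : V → I) (H : I → I → Prop) : Prop :=
  ∀ i j : I, i ≠ j → ∀ T : Set I, i ∉ T → j ∉ T →
    (DSepSet A (π ⁻¹' T) (π ⁻¹' {i}) (π ⁻¹' {j}) ↔ DSep H T i j)

section Walks

/-- `Active R T u v d`: some walk from `u` to `v` has all its colliders in `T` and all its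
other interior nodes outside `T`; `d` records whether its last arc points into `v`. -/
inductive Active (R : I → I → Prop) (T : Set I) (u : I) : I → Bool → Prop
  | start : Active R T u u false
  | down {v w : I} {d : Bool} : Active R T u v d → v ∉ T → R v w → Active R T u w true
  | up {v w : I} : Active R T u v false → v ∉ T → R w v → Active R T u w false
  | collide {v w : I} : Active R T u v true → v ∈ T → R w v → Active R T u w false

theorem Active.append {R : I → I → Prop} {T : Set I} {u v w : I} {d : Bool}
    (h₁ : Active R T u v false) (h₂ : Active R T v w d) : Active R T u w d := by
  induction h₂ with
  | start => exact h₁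
  | down _ ht hr ih => exact ih.down ht hr
  | up _ ht hr ih => exact ih.up ht hr
  | collide _ ht hr ih => exact ih.collide ht hr

theorem Active.eq_of_start_mem {R : I → I → Prop} {T : Set I} {u v : I} {d : Bool}
    (h : Active R T u v d) (hu : u ∈ T) : v = u ∧ d = false := by
  induction h with
  | start => exact ⟨rfl, rfl⟩
  | down _ ht _ ih => exact absurd (ih.1 ▸ hu) ht
  | up _ ht _ ih => exact absurd (ih.1 ▸ hu) ht
  | collide _ _ _ ih => exact absurd ih.2 (by simp)

/-- The arcs of `R'` are those of `R` together with arcs from `Q` into the new node `s`. -/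
structure SinkExtension (R R' : I → I → Prop) (s : I) (Q : I → Prop) : Prop where
  iff : ∀ u v, R' u v ↔ R u v ∨ (v = s ∧ Q u)
  source_ne : ∀ {u v}, R u v → u ≠ s
  target_ne : ∀ {u v}, R u v → v ≠ s
  parent_ne : ∀ {u}, Q u → u ≠ s

namespace SinkExtension

variable {R R' : I → I → Prop} {s : I} {Q : I → Prop} {T : Set I} {u v : I} {d : Bool}

theorem active_lift (h : SinkExtension R R' s Q) (hA : Active R (T \ {s}) u v d) (hu : u ≠ s) :
    v ≠ s ∧ Active R' T u v d := by
  induction hA with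
  | start => exact ⟨hu, .start⟩
  | down _ ht hr ih =>
    exact ⟨h.target_ne hr, ih.2.down (fun hv => ht ⟨hv, ih.1⟩) ((h.iff _ _).2 (.inl hr))⟩
  | up _ ht hr ih =>
    exact ⟨h.source_ne hr, ih.2.up (fun hv => ht ⟨hv, ih.1⟩) ((h.iff _ _).2 (.inl hr))⟩
  | collide _ ht hr ih =>
    exact ⟨h.source_ne hr, ih.2.collide ht.1 ((h.iff _ _).2 (.inl hr))⟩

theorem active_of_notMem (h : SinkExtension R R' s Q) (hs : s ∉ T) (hA : Active R' T u v d)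
    (hu : u ≠ s) :
    (v ≠ s ∧ Active R T u v d) ∨
      (v = s ∧ d = true ∧ ∃ a d', Q a ∧ a ∉ T ∧ Active R T u a d') := by
  have h1 := @h.source_ne
  have h2 := @h.target_ne
  have h3 := @h.parent_ne
  induction hA with
  | start => exact .inl ⟨hu, .start⟩
  | @down v w d _ ht hr ih =>
    rcases (h.iff _ _).1 hr with hr | ⟨rfl, hq⟩
    · rcases ih with ih | ih
      · exact .inl ⟨h2 hr, ih.2.down ht hr⟩
      · exact absurd ih.1 (h1 hr)
    · rcases ih with ih | ih
      · exact .inr ⟨rfl, rfl, v, d, hq, ht, ih.2⟩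
      · exact absurd ih.1 (h3 hq)
  | up _ ht hr ih =>
    rcases ih with ih | ih
    · rcases (h.iff _ _).1 hr with hr | hr
      · exact .inl ⟨h1 hr, ih.2.up ht hr⟩
      · exact absurd hr.1 ih.1
    · exact absurd ih.2.1 (by simp)
  | collide _ ht hr ih =>
    rcases ih with ih | ih
    · rcases (h.iff _ _).1 hr with hr | hr
      · exact .inl ⟨h1 hr, ih.2.collide ht hr⟩
      · exact absurd hr.1 ih.1
    · exact absurd (ih.1 ▸ ht) hs

theorem active_from_sink (h : SinkExtension R R' s Q) (hs : s ∉ T) (hA : Active R' T s v d) :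
    v = s ∨ ∃ a, Q a ∧ Active R T a v d := by
  have h1 := @h.source_ne
  have h3 := @h.parent_ne
  induction hA with
  | start => exact .inl rfl
  | down _ ht hr ih =>
    rcases (h.iff _ _).1 hr with hr | hr
    · rcases ih with ih | ⟨a, ha, ih⟩
      · exact absurd ih (h1 hr)
      · exact .inr ⟨a, ha, ih.down ht hr⟩
    · exact .inl hr.1
  | up _ ht hr ih =>
    rcases (h.iff _ _).1 hr with hr | hr
    · rcases ih with ih | ⟨a, ha, ih⟩
      · exact absurd ih (h.target_ne hr)
      · exact .inr ⟨a, ha, ih.up ht hr⟩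
    · exact .inr ⟨_, hr.2, .start⟩
  | collide _ ht hr ih =>
    rcases (h.iff _ _).1 hr with hr | hr
    · rcases ih with ih | ⟨a, ha, ih⟩
      · exact absurd ih (h.target_ne hr)
      · exact .inr ⟨a, ha, ih.collide ht hr⟩
    · exact absurd (hr.1 ▸ ht) hs

theorem active_of_mem (h : SinkExtension R R' s Q) (hs : s ∈ T) (hA : Active R' T u v d)
    (hu : u ≠ s) :
    (v ≠ s ∧ (Active R (T \ {s}) u v d ∨
      (∃ a d', Q a ∧ a ∉ T ∧ Active R (T \ {s}) u a d') ∧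
        ∃ b, Q b ∧ Active R (T \ {s}) b v d)) ∨
      (v = s ∧ d = true ∧ ∃ a d', Q a ∧ a ∉ T ∧ Active R (T \ {s}) u a d') := by
  have h1 := @h.source_ne
  have h2 := @h.target_ne
  have h3 := @h.parent_ne
  induction hA with
  | start => exact .inl ⟨hu, .inl .start⟩
  | @down v w d _ ht hr ih =>
    have ht' : v ∉ T \ {s} := fun hv => ht hv.1
    rcases (h.iff _ _).1 hr with hr | ⟨rfl, hq⟩
    · rcases ih with ⟨_, ih | ⟨ha, b, hb, ih⟩⟩ | ih
      · exact .inl ⟨h2 hr, .inl (ih.down ht' hr)⟩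
      · exact .inl ⟨h2 hr, .inr ⟨ha, b, hb, ih.down ht' hr⟩⟩
      · exact absurd ih.1 (h1 hr)
    · rcases ih with ⟨_, ih | ⟨ha, b, hb, ih⟩⟩ | ih
      · exact .inr ⟨rfl, rfl, v, d, hq, ht, ih⟩
      · exact .inr ⟨rfl, rfl, ha⟩
      · exact absurd ih.1 (h3 hq)
  | @up v w _ ht hr ih =>
    have ht' : v ∉ T \ {s} := fun hv => ht hv.1
    rcases (h.iff _ _).1 hr with hr | ⟨rfl, hq⟩
    · rcases ih with ⟨_, ih | ⟨ha, b, hb, ih⟩⟩ | ih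
      · exact .inl ⟨h1 hr, .inl (ih.up ht' hr)⟩
      · exact .inl ⟨h1 hr, .inr ⟨ha, b, hb, ih.up ht' hr⟩⟩
      · exact absurd ih.2.1 (by simp)
    · exact absurd hs ht
  | @collide v w _ ht hr ih =>
    rcases (h.iff _ _).1 hr with hr | ⟨rfl, hq⟩
    · have ht' : v ∈ T \ {s} := ⟨ht, h2 hr⟩
      rcases ih with ⟨_, ih | ⟨ha, b, hb, ih⟩⟩ | ih
      · exact .inl ⟨h1 hr, .inl (ih.collide ht' hr)⟩
      · exact .inl ⟨h1 hr, .inr ⟨ha, b, hb, ih.collide ht' hr⟩⟩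
      · exact absurd ih.1 (h2 hr)
    · rcases ih with ih | ih
      · exact absurd rfl ih.1
      · exact .inl ⟨h3 hq, .inr ⟨ih.2.2, w, hq, .start⟩⟩

end SinkExtension

theorem Active.turn {R : I → I → Prop} {T : Set I} {u c e : I} (hce : Relation.TransGen R c e)
    (he : e ∈ T) (hc : c ∉ T) (h : Active R T u c true) : Active R T u c false := by
  induction hce using Relation.TransGen.head_induction_on with
  | single hr => exact (h.down hc hr).collide he hr
  | @head a c' hr _ ih =>
    by_cases hc' : c' ∈ T
    · exact (h.down hc hr).collide hc' hr
    · exact (ih hc' (h.down hc hr)).up hc' hr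

theorem DConn.active {H : I → I → Prop} (hH : IsDAG H) {T : Set I} {u v : I} (hu : u ∉ T)
    (h : DConn H T u v) : ∃ d, Active H T u v d := by
  obtain ⟨n, p, -, h0, hn, hadj, hcond⟩ := h
  have key : ∀ (k : ℕ) (h : k + 1 < n + 2),
      (H (p ⟨k, by omega⟩) (p ⟨k + 1, h⟩) → Active H T u (p ⟨k + 1, h⟩) true) ∧
      (H (p ⟨k + 1, h⟩) (p ⟨k, by omega⟩) → Active H T u (p ⟨k + 1, h⟩) false) := by
    intro k
    induction k with
    | zero =>
      intro h
      have h0' : p ⟨0, by omega⟩ = u := h0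
      rw [h0']
      exact ⟨fun hr => Active.start.down hu hr, fun hr => Active.start.up hu hr⟩
    | succ k ih =>
      intro h
      obtain ⟨c1, c2⟩ := hcond k h
      obtain ⟨i1, i2⟩ := ih (by omega)
      have asym : ∀ a b, H a b → H b a → False := fun a b h1 h2 =>
        hH a (.tail (.single h1) h2)
      rcases hadj k (by omega) with ha | ha
      · refine ⟨fun hr => (i1 ha).down (c2 fun hc => asym _ _ hr hc.2) hr, fun hr => ?_⟩
        by_cases hT : p ⟨k + 1, by omega⟩ ∈ T
        · exact (i1 ha).collide hT hr
        · rcases c1 ⟨ha, hr⟩ with hT' | ⟨e, he, hanc⟩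
          · exact absurd hT' hT
          · exact ((i1 ha).turn hanc he hT).up hT hr
      · have hT := c2 fun hc => asym _ _ ha hc.1
        exact ⟨fun hr => (i2 ha).down hT hr, fun hr => (i2 ha).up hT hr⟩
  have hl : p ⟨n + 1, by omega⟩ = v := hn
  rcases hadj n (by omega) with ha | ha
  · exact ⟨true, hl ▸ (key n (by omega)).1 ha⟩
  · exact ⟨false, hl ▸ (key n (by omega)).2 ha⟩

/-- The first `n` arcs of `p` form a path from `u` to `v` that is d-connecting given `T`. -/
structure ConnPath (H : I → I → Prop) (T : Set I) (u v : I) (n : ℕ) (p : ℕ → I) : Prop where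
  first : p 0 = u
  last : p n = v
  inj : ∀ a b, a ≤ n → b ≤ n → p a = p b → a = b
  adj : ∀ k, k < n → Adj H (p k) (p (k + 1))
  collider : ∀ k, k + 1 < n → H (p k) (p (k + 1)) → H (p (k + 2)) (p (k + 1)) →
    ∃ e ∈ T, Relation.ReflTransGen H (p (k + 1)) e
  noncollider : ∀ k, k + 1 < n → ¬ (H (p k) (p (k + 1)) ∧ H (p (k + 2)) (p (k + 1))) →
    p (k + 1) ∉ T

namespace ConnPath

variable {H : I → I → Prop} {T : Set I} {u v w : I} {n : ℕ} {p : ℕ → I}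

theorem truncate (h : ConnPath H T u v n p) {k : ℕ} (hk : k ≤ n) : ConnPath H T u (p k) k p where
  first := h.first
  last := rfl
  inj a b ha hb := h.inj a b (by omega) (by omega)
  adj a ha := h.adj a (by omega)
  collider a ha := h.collider a (by omega)
  noncollider a ha := h.noncollider a (by omega)

theorem extend (h : ConnPath H T u v n p) (hw : ∀ k ≤ n, p k ≠ w) (hadj : Adj H v w)
    (hc : ∀ m, n = m + 1 → H (p m) v → H w v → ∃ e ∈ T, Relation.ReflTransGen H v e)
    (hn : ∀ m, n = m + 1 → ¬ (H (p m) v ∧ H w v) → v ∉ T) :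
    ConnPath H T u w (n + 1) (Function.update p (n + 1) w) := by
  have e1 : ∀ k, k ≤ n → Function.update p (n + 1) w k = p k := fun k hk =>
    Function.update_of_ne (by omega) _ _
  have e2 : Function.update p (n + 1) w (n + 1) = w := Function.update_self ..
  refine ⟨by rw [e1 _ (by omega), h.first], e2, ?_, ?_, ?_, ?_⟩
  · intro a b ha hb hab
    rcases Nat.lt_or_ge n a with ha' | ha' <;> rcases Nat.lt_or_ge n b with hb' | hb'
    · omega
    · obtain rfl : a = n + 1 := by omega
      rw [e2, e1 b hb'] at hab
      exact absurd hab.symm (hw b hb')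
    · obtain rfl : b = n + 1 := by omega
      rw [e2, e1 a ha'] at hab
      exact absurd hab (hw a ha')
    · rw [e1 a ha', e1 b hb'] at hab
      exact h.inj a b ha' hb' hab
  · intro k hk
    rw [e1 k (by omega)]
    rcases Nat.lt_or_ge k n with hk' | hk'
    · rw [e1 _ (by omega)]
      exact h.adj k hk'
    · obtain rfl : k = n := by omega
      rw [e2, h.last]
      exact hadj
  · intro k hk
    rw [e1 k (by omega), e1 (k + 1) (by omega)]
    rcases Nat.lt_or_ge (k + 1) n with hk' | hk'
    · rw [e1 _ (by omega)]
      exact h.collider k hk'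
    · obtain rfl : n = k + 1 := by omega
      rw [e2, h.last]
      exact hc k rfl
  · intro k hk
    rw [e1 k (by omega), e1 (k + 1) (by omega)]
    rcases Nat.lt_or_ge (k + 1) n with hk' | hk'
    · rw [e1 _ (by omega)]
      exact h.noncollider k hk'
    · obtain rfl : n = k + 1 := by omega
      rw [e2, h.last]
      exact hn k rfl

/-- A forward arc followed later by a backward final arc encloses a collider. -/
theorem ancestor_of_turn (h : ConnPath H T u v n p) {m : ℕ} (hm : n = m + 1)
    (hb : ¬ H (p m) (p (m + 1))) :
    ∀ j k, k + j = m → H (p k) (p (k + 1)) → ∃ e ∈ T, Relation.ReflTransGen H (p k) e := by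
  intro j
  induction j with
  | zero => rintro k rfl hf; exact absurd hf hb
  | succ j ih =>
    intro k hk hf
    have : ∃ e ∈ T, Relation.ReflTransGen H (p (k + 1)) e := by
      rcases h.adj (k + 1) (by omega) with hf' | hf'
      · exact ih (k + 1) (by omega) hf'
      · exact h.collider k (by omega) hf hf'
    obtain ⟨e, he, hr⟩ := this
    exact ⟨e, he, hr.head hf⟩

theorem dconn (h : ConnPath H T u v n p) (huv : u ≠ v) : DConn H T u v := by
  obtain ⟨m, rfl⟩ : ∃ m, n = m + 1 := by
    rcases n with _ | m
    · exact absurd (h.first.symm.trans h.last) huv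
    · exact ⟨m, rfl⟩
  refine ⟨m, fun k => p k, ?_, h.first, h.last, fun k hk => h.adj k (by omega), fun k hk => ?_⟩
  · intro a b hab
    exact Fin.ext (h.inj a b (by omega) (by omega) hab)
  · refine ⟨fun hc => ?_, h.noncollider k (by omega)⟩
    obtain ⟨e, he, hr⟩ := h.collider k (by omega) hc.1 hc.2
    rcases Relation.reflTransGen_iff_eq_or_transGen.1 hr with rfl | hr
    · exact .inl he
    · exact .inr ⟨e, he, hr⟩

end ConnPath

theorem Active.exists_connPath {H : I → I → Prop} (hH : IsDAG H) {T : Set I} {u v : I} {d : Bool}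
    (hu : u ∉ T) (h : Active H T u v d) :
    ∃ n p, ConnPath H T u v n p ∧
      (d = true → (∃ m, n = m + 1 ∧ H (p m) v) ∨ v ∉ T) ∧
      (d = false → (∀ m, n = m + 1 → H v (p m)) ∨ ∃ e ∈ T, Relation.ReflTransGen H v e) := by
  have asym : ∀ a b, H a b → H b a → False := fun a b h1 h2 =>
    hH a (.tail (.single h1) h2)
  have irr : ∀ a, ¬ H a a := fun a h => hH a (.single h)
  induction h with
  | start =>
    exact ⟨0, fun _ => u, ⟨rfl, rfl, fun a b ha hb _ => by omega, fun k hk => by omega,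
      fun k hk => by omega, fun k hk => by omega⟩, by simp, fun _ => .inl fun m hm => by omega⟩
  | @down v w d _ ht hr ih =>
    obtain ⟨n, p, hp, -, -⟩ := ih
    by_cases hw : ∃ k ≤ n, p k = w
    · obtain ⟨k, hk, rfl⟩ := hw
      refine ⟨k, p, hp.truncate hk, fun _ => ?_, by simp⟩
      rcases k with _ | k
      · exact .inr (by rw [hp.first]; exact hu)
      · by_cases hf : H (p k) (p (k + 1))
        · exact .inl ⟨k, rfl, hf⟩
        · have hne : k + 1 ≠ n := by
            rintro rfl
            rw [hp.last] at hr
            exact irr _ hr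
          exact .inr (hp.noncollider k (by omega) fun hc => hf hc.1)
    · push Not at hw
      refine ⟨n + 1, _, hp.extend hw (.inl hr) (fun m _ _ h2 => (asym _ _ hr h2).elim)
        (fun _ _ _ => ht), fun _ => .inl ⟨n, rfl, ?_⟩, by simp⟩
      rw [Function.update_of_ne (by omega), hp.last]
      exact hr
  | @up v w _ ht hr ih =>
    obtain ⟨n, p, hp, -, ih⟩ := ih
    replace ih := ih rfl
    by_cases hw : ∃ k ≤ n, p k = w
    · obtain ⟨k, hk, rfl⟩ := hw
      refine ⟨k, p, hp.truncate hk, by simp, fun _ => ?_⟩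
      rcases ih with ih | ⟨e, he, hve⟩
      · have hne : k ≠ n := by
          rintro rfl
          rw [hp.last] at hr
          exact irr _ hr
        obtain ⟨m, rfl⟩ : ∃ m, n = m + 1 := ⟨n - 1, by omega⟩
        have hb := ih m rfl
        rcases hp.adj k (by omega) with hf | hf
        · exact .inr (hp.ancestor_of_turn rfl (fun hc => asym _ _ hc (hp.last ▸ hb)) (m - k) k
            (by omega) hf)
        · by_cases hk0 : ∃ j, k = j + 1 ∧ H (p j) (p k)
          · obtain ⟨j, rfl, hj⟩ := hk0
            exact .inr (hp.collider j (by omega) hj hf)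
          · refine .inl fun j hj => ?_
            subst hj
            rcases hp.adj j (by omega) with h1 | h1
            · exact absurd ⟨j, rfl, h1⟩ hk0
            · exact h1
      · exact .inr ⟨e, he, hve.head hr⟩
    · push Not at hw
      refine ⟨n + 1, _, hp.extend hw (.inr hr) (fun m hm h1 _ => ?_) (fun _ _ _ => ht), by simp,
        fun _ => .inl fun m hm => ?_⟩
      · rcases ih with ih | ih
        · exact (asym _ _ h1 (ih m hm)).elim
        · exact ih
      · obtain rfl : n = m := by omega
        rw [Function.update_of_ne (by omega), hp.last]
        exact hr
  | @collide v w _ ht hr ih =>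
    obtain ⟨n, p, hp, ih, -⟩ := ih
    replace ih := (ih rfl).resolve_right (fun hc => hc ht)
    obtain ⟨m, rfl, hm⟩ := ih
    by_cases hw : ∃ k ≤ m + 1, p k = w
    · obtain ⟨k, hk, rfl⟩ := hw
      exact ⟨k, p, hp.truncate hk, by simp, fun _ => .inr ⟨v, ht, .single hr⟩⟩
    · push Not at hw
      refine ⟨m + 1 + 1, _, hp.extend hw (.inr hr) (fun _ _ _ _ => ⟨v, ht, .refl⟩)
        (fun j hj hc => ?_), by simp, fun _ => .inl fun j hj => ?_⟩
      · obtain rfl : m = j := by omega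
        exact absurd ⟨hm, hr⟩ hc
      · obtain rfl : m + 1 = j := by omega
        rw [Function.update_of_ne (by omega), hp.last]
        exact hr

theorem Active.dconn {H : I → I → Prop} (hH : IsDAG H) {T : Set I} {u v : I} {d : Bool}
    (hu : u ∉ T) (huv : u ≠ v) (h : Active H T u v d) : DConn H T u v := by
  obtain ⟨n, p, hp, -⟩ := h.exists_connPath hH hu
  exact hp.dconn huv

theorem Adj.dconn {H : I → I → Prop} {u v : I} (h : Adj H u v) (huv : u ≠ v) (T : Set I) :
    DConn H T u v := by
  refine ConnPath.dconn (n := 1) (p := fun k => if k = 0 then u else v)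
    ⟨rfl, rfl, fun a b ha hb hab => ?_, fun k hk => ?_, fun k hk => by omega,
      fun k hk => by omega⟩ huv
  · interval_cases a <;> interval_cases b <;> simp_all [Ne.symm huv]
  · obtain rfl : k = 0 := by omega
    exact h

end Walks

section Model

/-- Average out the coordinate `s`, which is `true` with probability `θ s x`. -/
noncomputable def avg (θ : I → (I → Bool) → ℝ) (s : I) (F : (I → Bool) → ℝ) (x : I → Bool) : ℝ :=
  θ s x * F (Function.update x s true) + (1 - θ s x) * F (Function.update x s false)

/-- Expectation in the Bayesian network with conditional probabilities `θ` and nodes `l`,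
listed with children before parents; nodes outside `l` are constantly `true`. -/
noncomputable def expect (θ : I → (I → Bool) → ℝ) : List I → ((I → Bool) → ℝ) → ℝ
  | [], F => F fun _ => true
  | s :: l, F => expect θ l (avg θ s F)

/-- `l` is closed under parents and lists every node before its parents. -/
def Topological (H : I → I → Prop) : List I → Prop
  | [] => True
  | s :: l => s ∉ l ∧ (∀ u, H u s → u ∈ l) ∧ Topological H l

/-- The arcs of `H` into nodes of `l`. -/
def arcsInto (H : I → I → Prop) (l : List I) (u v : I) : Prop := H u v ∧ v ∈ l

/-- Indicator of the event that `x` agrees with `t` on `T`. -/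
noncomputable def ev (T : Set I) (t x : I → Bool) : ℝ := if ∀ k ∈ T, x k = t k then 1 else 0

/-- The conditional probability of each node is a function of its parents. -/
def Markov (H : I → I → Prop) (θ : I → (I → Bool) → ℝ) : Prop :=
  ∀ v, DependsOn (θ v) {u | H u v}

theorem Topological.parent_mem {H : I → I → Prop} {l : List I} (h : Topological H l) {u v : I}
    (hv : v ∈ l) (huv : H u v) : u ∈ l := by
  induction l with
  | nil => simp at hv
  | cons s l ih =>
    rcases List.mem_cons.1 hv with rfl | hv
    · exact List.mem_cons_of_mem _ (h.2.1 u huv)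
    · exact List.mem_cons_of_mem _ (ih h.2.2 hv)

theorem Topological.sinkExtension {H : I → I → Prop} {s : I} {l : List I}
    (h : Topological H (s :: l)) :
    SinkExtension (arcsInto H l) (arcsInto H (s :: l)) s (fun u => H u s) where
  iff u v := by
    simp only [arcsInto, List.mem_cons]
    constructor
    · rintro ⟨h1, rfl | h2⟩
      · exact .inr ⟨rfl, h1⟩
      · exact .inl ⟨h1, h2⟩
    · rintro (⟨h1, h2⟩ | ⟨rfl, h1⟩)
      · exact ⟨h1, .inr h2⟩
      · exact ⟨h1, .inl rfl⟩
  source_ne := by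
    rintro u v hr rfl
    exact h.1 (h.2.2.parent_mem hr.2 hr.1)
  target_ne := by
    rintro u v hr rfl
    exact h.1 hr.2
  parent_ne := by
    rintro u hr rfl
    exact h.1 (h.2.1 _ hr)

theorem exists_topological [Finite I] {H : I → I → Prop} (hH : IsDAG H) :
    ∃ l : List I, Topological H l ∧ ∀ v, v ∈ l := by
  have := Fintype.ofFinite I
  have wf : WellFounded (Relation.TransGen H) := by
    have : Std.Irrefl (Relation.TransGen H) := ⟨hH⟩
    exact Finite.wellFounded_of_trans_of_irrefl _
  suffices ∀ n, ∀ l : List I, Topological H l → (Finset.univ.filter (· ∉ l)).card = n →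
      ∃ l : List I, Topological H l ∧ ∀ v, v ∈ l from this _ [] trivial rfl
  intro n
  induction n with
  | zero =>
    intro l hl hn
    refine ⟨l, hl, fun v => ?_⟩
    by_contra hv
    have : v ∈ Finset.univ.filter (· ∉ l) := by simp [hv]
    rw [Finset.card_eq_zero.1 hn] at this
    simp at this
  | succ n ih =>
    intro l hl hn
    obtain ⟨w, hw⟩ := Finset.card_pos.1 (by omega : 0 < (Finset.univ.filter (· ∉ l)).card)
    obtain ⟨s, hs, hmin⟩ := wf.has_min {v | v ∉ l} ⟨w, (Finset.mem_filter.1 hw).2⟩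
    refine ih (s :: l) ⟨hs, fun u hu => ?_, hl⟩ ?_
    · by_contra hul
      exact hmin u hul (.single hu)
    · have : Finset.univ.filter (· ∉ s :: l) = (Finset.univ.filter (· ∉ l)).erase s := by
        ext v; simp
      rw [this, Finset.card_erase_of_mem (by simpa using hs), hn]
      rfl

theorem update_eq_of_dependsOn {F : (I → Bool) → ℝ} {S : Set I} (hF : DependsOn F S) {s : I}
    (hs : s ∉ S) (x : I → Bool) (b : Bool) : F (Function.update x s b) = F x :=
  hF fun k hk => Function.update_of_ne (by rintro rfl; exact hs hk) _ _

theorem dependsOn_ev (T : Set I) (t : I → Bool) : DependsOn (ev T t) T := by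
  intro x y hxy
  unfold ev
  congr 1
  exact propext (forall₂_congr fun k hk => by rw [hxy k hk])

theorem ev_update {T : Set I} {s : I} (hs : s ∈ T) (t x : I → Bool) (b : Bool) :
    ev T t (Function.update x s b) = if b = t s then ev (T \ {s}) t x else 0 := by
  unfold ev
  split_ifs with h1 h2 h3 h2 h3
  · rfl
  · refine absurd (fun k hk => ?_) h3
    have := h1 k hk.1
    rwa [Function.update_of_ne hk.2] at this
  · exact absurd (by simpa using h1 s hs) h2
  · refine absurd (fun k hk => ?_) h1
    by_cases hks : k = s
    · subst hks; simpa using h2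
    · rw [Function.update_of_ne hks]; exact h3 k ⟨hk, hks⟩
  · rfl
  · rfl

theorem avg_mul_of_update_eq (θ : I → (I → Bool) → ℝ) {s : I} (F : (I → Bool) → ℝ)
    {G : (I → Bool) → ℝ} (hG : ∀ x b, G (Function.update x s b) = G x) :
    avg θ s (fun x => F x * G x) = fun x => avg θ s F x * G x := by
  funext x
  simp only [avg, hG]
  ring

theorem avg_of_update_eq (θ : I → (I → Bool) → ℝ) {s : I}
    {G : (I → Bool) → ℝ} (hG : ∀ x b, G (Function.update x s b) = G x) :
    avg θ s G = G := by
  funext x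
  simp only [avg, hG]
  ring

theorem avg_mul_ev (θ : I → (I → Bool) → ℝ) {s : I} (F : (I → Bool) → ℝ) {T : Set I} (hs : s ∈ T)
    (t : I → Bool) :
    avg θ s (fun x => F x * ev T t x) = fun x =>
      F (Function.update x s (t s)) * (if t s then θ s x else 1 - θ s x) * ev (T \ {s}) t x := by
  funext x
  simp only [avg, ev_update hs]
  cases t s <;> simp <;> ring

/-- Conditional independence of `X` and `Y` given `T`, stated for arbitrary test functions. -/
def Exchange (E : ((I → Bool) → ℝ) → ℝ) (X Y T : Set I) : Prop :=
  ∀ (t : I → Bool) (f f' g g' : (I → Bool) → ℝ), DependsOn f (X ∪ T) → DependsOn f' (X ∪ T) →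
    DependsOn g (Y ∪ T) → DependsOn g' (Y ∪ T) →
    E (fun x => f x * g x * ev T t x) * E (fun x => f' x * g' x * ev T t x) =
      E (fun x => f x * g' x * ev T t x) * E (fun x => f' x * g x * ev T t x)

theorem Exchange.symm {E : ((I → Bool) → ℝ) → ℝ} {X Y T : Set I} (h : Exchange E X Y T) :
    Exchange E Y X T := by
  intro t f f' g g' hf hf' hg hg'
  have := h t g g' f f' hg hg' hf hf'
  simp only [mul_comm (g _), mul_comm (g' _)] at this
  rw [this, mul_comm]

theorem dependsOn_avg {θ : I → (I → Bool) → ℝ} {s : I} {F : (I → Bool) → ℝ} {S P : Set I}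
    (hF : DependsOn F S) (hθ : DependsOn (θ s) P) : DependsOn (avg θ s F) (S \ {s} ∪ P) := by
  intro x y hxy
  have h1 : θ s x = θ s y := hθ fun k hk => hxy k (.inr hk)
  have h2 : ∀ b, F (Function.update x s b) = F (Function.update y s b) := fun b =>
    hF fun k hk => by
      by_cases hks : k = s
      · subst hks; simp
      · rw [Function.update_of_ne hks, Function.update_of_ne hks]; exact hxy k (.inl ⟨hk, hks⟩)
  simp only [GroupBN.avg, h1, h2]

theorem dependsOn_comp_update {s : I} {F : (I → Bool) → ℝ} {S : Set I} (hF : DependsOn F S)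
    (b : Bool) : DependsOn (fun x => F (Function.update x s b)) (S \ {s}) := by
  intro x y hxy
  refine hF fun k hk => ?_
  by_cases hks : k = s
  · subst hks; simp
  · rw [Function.update_of_ne hks, Function.update_of_ne hks]; exact hxy k ⟨hk, hks⟩

theorem dependsOn_mul {F G : (I → Bool) → ℝ} {S : Set I} (hF : DependsOn F S)
    (hG : DependsOn G S) : DependsOn (fun x => F x * G x) S :=
  fun x y hxy => by simp only [hF hxy, hG hxy]

theorem exchange_avg_left {H : I → I → Prop} {θ : I → (I → Bool) → ℝ} (hθ : Markov H θ) {s : I}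
    {l : List I} {X Y T : Set I} (hY : s ∉ Y) (hT : s ∉ T)
    (ih : Exchange (expect θ l) (X \ {s} ∪ {a | H a s ∧ a ∉ T}) Y T) :
    Exchange (expect θ (s :: l)) X Y T := by
  intro t f f' g g' hf hf' hg hg'
  have dep : ∀ f, DependsOn f (X ∪ T) →
      DependsOn (avg θ s f) (X \ {s} ∪ {a | H a s ∧ a ∉ T} ∪ T) := fun f hf =>
    (dependsOn_avg hf (hθ s)).mono fun k hk => by
      simp only [Set.mem_union, Set.mem_sdiff, Set.mem_ofPred_eq, Set.mem_singleton_iff] at hk ⊢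
      tauto
  have push : ∀ f g, DependsOn g (Y ∪ T) →
      expect θ (s :: l) (fun x => f x * g x * ev T t x) =
        expect θ l (fun x => avg θ s f x * g x * ev T t x) := fun f g hg => by
    rw [expect,
      avg_mul_of_update_eq θ _ fun x b => update_eq_of_dependsOn (dependsOn_ev T t) hT x b,
      avg_mul_of_update_eq θ _ fun x b => update_eq_of_dependsOn hg (by simp [hY, hT]) x b]
  rw [push f g hg, push f' g' hg', push f g' hg', push f' g hg]
  exact ih t _ _ g g' (dep f hf) (dep f' hf') hg hg'

theorem exchange_condition_right {H : I → I → Prop} {θ : I → (I → Bool) → ℝ} (hθ : Markov H θ)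
    {s : I} {l : List I} {X Y T : Set I} (hs : s ∈ T)
    (ih : Exchange (expect θ l) X (Y ∪ {a | H a s ∧ a ∉ T \ {s}}) (T \ {s})) :
    Exchange (expect θ (s :: l)) X Y T := by
  intro t f f' g g' hf hf' hg hg'
  set w : (I → Bool) → ℝ := fun x => if t s then θ s x else 1 - θ s x with hw
  have depw : DependsOn w {u | H u s} := fun x y hxy => by simp only [hw, hθ s hxy]
  have dep : ∀ {f : (I → Bool) → ℝ} {X : Set I}, DependsOn f (X ∪ T) →
      DependsOn (fun x => f (Function.update x s (t s))) (X ∪ T \ {s}) := fun hf =>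
    (dependsOn_comp_update hf _).mono fun k hk => by
      simp only [Set.mem_union, Set.mem_sdiff] at hk ⊢
      tauto
  have depg : ∀ g : (I → Bool) → ℝ, DependsOn g (Y ∪ T) →
      DependsOn (fun x => g (Function.update x s (t s)) * w x)
        (Y ∪ {a | H a s ∧ a ∉ T \ {s}} ∪ T \ {s}) := fun g hg =>
    dependsOn_mul ((dep hg).mono (by
      intro k hk
      simp only [Set.mem_union] at hk ⊢
      tauto)) (depw.mono fun k hk => by
      simp only [Set.mem_union, Set.mem_ofPred_eq] at hk ⊢
      tauto)
  have push : ∀ f g : (I → Bool) → ℝ,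
      expect θ (s :: l) (fun x => f x * g x * ev T t x) =
        expect θ l (fun x => f (Function.update x s (t s)) *
          (g (Function.update x s (t s)) * w x) * ev (T \ {s}) t x) := fun f g => by
    rw [expect, avg_mul_ev θ _ hs]
    simp only [hw, mul_assoc]
  rw [push, push, push, push]
  exact ih t _ _ _ _ (dep hf) (dep hf') (depg g hg) (depg g' hg')

theorem exchange_of_not_active {H : I → I → Prop} {θ : I → (I → Bool) → ℝ} (hθ : Markov H θ)
    {l : List I} (hl : Topological H l) {X Y T : Set I} (hXT : ∀ x ∈ X, x ∉ T)
    (hYT : ∀ y ∈ Y, y ∉ T)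
    (hsep : ∀ x ∈ X, ∀ y ∈ Y, ∀ d, ¬ Active (arcsInto H l) T x y d) :
    Exchange (expect θ l) X Y T := by
  induction l generalizing X Y T with
  | nil =>
    intro t f f' g g' _ _ _ _
    simp only [expect]
    ring
  | cons s l ih =>
    have hS := hl.sinkExtension
    have hXY : ∀ x ∈ X, x ∉ Y := fun x hx hy => hsep x hx x hy _ .start
    by_cases hsT : s ∈ T
    · have hne : ∀ {v}, v ∉ T → v ≠ s := fun hv hvs => hv (hvs ▸ hsT)
      have hT' : ∀ {v}, v ∉ T → v ∉ T \ {s} := fun hv h => hv h.1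
      have lift : ∀ {u v d}, u ≠ s → Active (arcsInto H l) (T \ {s}) u v d →
          Active (arcsInto H (s :: l)) T u v d := fun hu h => (hS.active_lift h hu).2
      have hbase : ∀ x ∈ X, ∀ y ∈ Y, ∀ d, ¬ Active (arcsInto H l) (T \ {s}) x y d :=
        fun x hx y hy d h => hsep x hx y hy d (lift (hne (hXT x hx)) h)
      have hcross : ∀ x ∈ X, ∀ y ∈ Y, ∀ a b d d', H a s → a ∉ T \ {s} → H b s →
          Active (arcsInto H l) (T \ {s}) x a d → Active (arcsInto H l) (T \ {s}) b y d' →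
          False := by
        intro x hx y hy a b d d' ha haT hb h1 h2
        refine hsep x hx y hy _ (((((lift (hne (hXT x hx)) h1).down
          (fun h => haT ⟨h, hS.parent_ne ha⟩) ((hS.iff _ _).2 (.inr ⟨rfl, ha⟩))).collide hsT
          ((hS.iff _ _).2 (.inr ⟨rfl, hb⟩)))).append (lift (hS.parent_ne hb) h2))
      by_cases hPX : ∃ x ∈ X, ∃ a d, H a s ∧ a ∉ T \ {s} ∧
          Active (arcsInto H l) (T \ {s}) x a d
      · obtain ⟨x, hx, a, d, ha, haT, h1⟩ := hPX
        refine (exchange_condition_right hθ hsT (ih hl.2.2 ?_ ?_ ?_).symm).symm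
        · rintro z (hz | hz)
          exacts [hT' (hXT z hz), hz.2]
        · exact fun y hy => hT' (hYT y hy)
        · rintro z (hz | hz) y hy d' h2
          · exact hbase z hz y hy d' h2
          · exact hcross x hx y hy a z d d' ha haT hz.1 h1 h2
      · refine exchange_condition_right hθ hsT (ih hl.2.2 ?_ ?_ ?_)
        · exact fun y hy => hT' (hXT y hy)
        · rintro z (hz | hz)
          exacts [hT' (hYT z hz), hz.2]
        · rintro x hx z (hz | hz) d h1
          · exact hbase x hx z hz d h1
          · exact hPX ⟨x, hx, z, d, hz.1, hz.2, h1⟩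
    · have hTs : T \ {s} = T := Set.sdiff_singleton_eq_self hsT
      have lift : ∀ {u v d}, u ≠ s → Active (arcsInto H l) T u v d →
          v ≠ s ∧ Active (arcsInto H (s :: l)) T u v d := fun hu h =>
        hS.active_lift (hTs.symm ▸ h) hu
      have pa : ∀ {a}, H a s → arcsInto H (s :: l) a s := fun ha => ⟨ha, List.mem_cons_self⟩
      by_cases hsY : s ∈ Y
      · have hsX : s ∉ X := fun h => hXY s h hsY
        have hne : ∀ x ∈ X, x ≠ s := fun x hx h => hsX (h ▸ hx)
        refine (exchange_avg_left hθ hsX hsT (ih hl.2.2 hXT ?_ ?_).symm).symm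
        · rintro z (hz | hz)
          exacts [hYT z hz.1, hz.2]
        · rintro x hx z (hz | hz) d h
          · exact hsep x hx z hz.1 d (lift (hne x hx) h).2
          · exact hsep x hx s hsY true ((lift (hne x hx) h).2.down hz.2 (pa hz.1))
      by_cases hsX : s ∈ X
      · refine exchange_avg_left hθ hsY hsT (ih hl.2.2 ?_ hYT ?_)
        · rintro z (hz | hz)
          exacts [hXT z hz.1, hz.2]
        · rintro z (hz | hz) y hy d h
          · exact hsep z hz.1 y hy d (lift hz.2 h).2
          · exact hsep s hsX y hy d ((Active.start.up hsT (pa hz.1)).append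
              (lift (hS.parent_ne hz.1) h).2)
      · intro t f f' g g' hf hf' hg hg'
        have push : ∀ f g, DependsOn f (X ∪ T) → DependsOn g (Y ∪ T) →
            expect θ (s :: l) (fun x => f x * g x * ev T t x) =
              expect θ l (fun x => f x * g x * ev T t x) := fun f g hf hg => by
          rw [expect, avg_of_update_eq]
          intro x b
          rw [update_eq_of_dependsOn (dependsOn_ev T t) hsT,
            update_eq_of_dependsOn hf (by simp [hsX, hsT]),
            update_eq_of_dependsOn hg (by simp [hsY, hsT])]
        rw [push f g hf hg, push f' g' hf' hg', push f g' hf hg', push f' g hf' hg]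
        exact ih hl.2.2 hXT hYT (fun x hx y hy d h => hsep x hx y hy d
          (lift (fun h => hsX (h ▸ hx)) h).2) t f f' g g' hf hf' hg hg'

theorem expect_add (θ : I → (I → Bool) → ℝ) (l : List I) (F G : (I → Bool) → ℝ) :
    expect θ l (fun x => F x + G x) = expect θ l F + expect θ l G := by
  induction l generalizing F G with
  | nil => rfl
  | cons s l ih =>
    simp only [expect, ← ih]
    congr 1
    funext x
    simp only [avg]
    ring

theorem expect_const_mul (θ : I → (I → Bool) → ℝ) (l : List I) (c : ℝ) (F : (I → Bool) → ℝ) :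
    expect θ l (fun x => c * F x) = c * expect θ l F := by
  induction l generalizing F with
  | nil => rfl
  | cons s l ih =>
    simp only [expect, ← ih]
    congr 1
    funext x
    simp only [avg]
    ring

theorem expect_const (θ : I → (I → Bool) → ℝ) (l : List I) (c : ℝ) :
    expect θ l (fun _ => c) = c := by
  induction l with
  | nil => rfl
  | cons s l ih => rw [expect, avg_of_update_eq θ fun _ _ => rfl, ih]

theorem expect_sum {ι : Type*} (θ : I → (I → Bool) → ℝ) (l : List I) (A : Finset ι)
    (F : ι → (I → Bool) → ℝ) :
    expect θ l (fun x => ∑ a ∈ A, F a x) = ∑ a ∈ A, expect θ l (F a) := by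
  induction A using Finset.induction_on with
  | empty => simpa using expect_const θ l 0
  | insert a A ha ih =>
    simp only [Finset.sum_insert ha]
    rw [expect_add, ih]

/-- The networks on `H`: conditional probabilities in `[0, 1]` depending only on the parents. -/
def networks (H : I → I → Prop) : Set (I → (I → Bool) → ℝ) :=
  {θ | Markov H θ ∧ ∀ v x, 0 ≤ θ v x ∧ θ v x ≤ 1}

theorem expect_nonneg {H : I → I → Prop} {θ : I → (I → Bool) → ℝ} (hθ : θ ∈ networks H)
    (l : List I) {F : (I → Bool) → ℝ} (hF : ∀ x, 0 ≤ F x) : 0 ≤ expect θ l F := by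
  induction l generalizing F with
  | nil => exact hF _
  | cons s l ih =>
    refine ih fun x => add_nonneg (mul_nonneg (hθ.2 s x).1 (hF _)) (mul_nonneg ?_ (hF _))
    linarith [(hθ.2 s x).2]

theorem expect_update (θ : I → (I → Bool) → ℝ) {l : List I} {s : I} (hs : s ∉ l)
    (η : (I → Bool) → ℝ) : expect (Function.update θ s η) l = expect θ l := by
  induction l with
  | nil => rfl
  | cons r l ih =>
    simp only [List.mem_cons, not_or] at hs
    funext F
    simp only [expect, ih hs.2]
    congr 1
    funext x
    simp only [avg, Function.update_of_ne (Ne.symm hs.1)]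

theorem update_mem_networks {H : I → I → Prop} {θ : I → (I → Bool) → ℝ} (hθ : θ ∈ networks H)
    {s : I} {η : (I → Bool) → ℝ} (hη : DependsOn η {u | H u s})
    (h01 : ∀ x, 0 ≤ η x ∧ η x ≤ 1) : Function.update θ s η ∈ networks H := by
  refine ⟨fun v => ?_, fun v x => ?_⟩
  · rcases eq_or_ne v s with rfl | hv
    · rwa [Function.update_self]
    · rw [Function.update_of_ne hv]; exact hθ.1 v
  · rcases eq_or_ne v s with rfl | hv
    · rw [Function.update_self]; exact h01 x
    · rw [Function.update_of_ne hv]; exact hθ.2 v x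

theorem half_mem_networks (H : I → I → Prop) : (fun _ _ => 1 / 2) ∈ networks H :=
  ⟨fun _ _ _ _ => rfl, fun _ _ => by norm_num⟩

theorem convex_networks (H : I → I → Prop) : Convex ℝ (networks H) := by
  intro θ hθ η hη a b ha hb hab
  refine ⟨fun v x y hxy => ?_, fun v x => ?_⟩
  · simp only [Pi.add_apply, Pi.smul_apply, hθ.1 v hxy, hη.1 v hxy]
  · obtain ⟨h1, h2⟩ := hθ.2 v x
    obtain ⟨h3, h4⟩ := hη.2 v x
    simp only [Pi.add_apply, Pi.smul_apply, smul_eq_mul]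
    constructor
    · positivity
    · nlinarith

theorem expect_half_ev_ne_zero {l : List I} (T : Set I) (hT : ∀ v ∈ T, v ∈ l) (t : I → Bool) :
    expect (fun _ _ => 1 / 2) l (ev T t) ≠ 0 := by
  induction l generalizing T with
  | nil =>
    have : ∀ k ∈ T, t k = true := fun k hk => absurd (hT k hk) (by simp)
    simp only [expect, ev]
    rw [if_pos fun k hk => (this k hk).symm]
    exact one_ne_zero
  | cons s l ih =>
    by_cases hs : s ∈ T
    · have h : avg (fun _ _ => 1 / 2) s (ev T t) = fun x => 1 / 2 * ev (T \ {s}) t x := by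
        have := avg_mul_ev (fun _ _ => 1 / 2) (fun _ => 1) hs t
        simp only [one_mul] at this
        rw [show ev T t = fun x => ev T t x from rfl, this]
        funext x
        split_ifs <;> ring
      rw [expect, h, expect_const_mul]
      refine mul_ne_zero (by norm_num) (ih _ fun v hv => ?_)
      exact (List.mem_cons.1 (hT v hv.1)).resolve_left hv.2
    · rw [expect, avg_of_update_eq _ fun x b => update_eq_of_dependsOn (dependsOn_ev T t) hs x b]
      refine ih _ fun v hv => (List.mem_cons.1 (hT v hv)).resolve_left ?_
      rintro rfl
      exact hs hv

/-- Real functions given by a polynomial. -/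
def IsPoly (g : ℝ → ℝ) : Prop := ∃ P : Polynomial ℝ, ∀ t, g t = P.eval t

theorem IsPoly.add {f g : ℝ → ℝ} (hf : IsPoly f) (hg : IsPoly g) : IsPoly fun t => f t + g t := by
  obtain ⟨P, hP⟩ := hf
  obtain ⟨Q, hQ⟩ := hg
  exact ⟨P + Q, fun t => by simp [hP, hQ]⟩

theorem IsPoly.mul {f g : ℝ → ℝ} (hf : IsPoly f) (hg : IsPoly g) : IsPoly fun t => f t * g t := by
  obtain ⟨P, hP⟩ := hf
  obtain ⟨Q, hQ⟩ := hg
  exact ⟨P * Q, fun t => by simp [hP, hQ]⟩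

theorem IsPoly.sub {f g : ℝ → ℝ} (hf : IsPoly f) (hg : IsPoly g) : IsPoly fun t => f t - g t := by
  obtain ⟨P, hP⟩ := hf
  obtain ⟨Q, hQ⟩ := hg
  exact ⟨P - Q, fun t => by simp [hP, hQ]⟩

theorem isPoly_const (c : ℝ) : IsPoly fun _ => c := ⟨.C c, fun t => by simp⟩

theorem isPoly_expect {θ : ℝ → I → (I → Bool) → ℝ} (hθ : ∀ v x, IsPoly fun t => θ t v x)
    (l : List I) {F : ℝ → (I → Bool) → ℝ} (hF : ∀ x, IsPoly fun t => F t x) :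
    IsPoly fun t => expect (θ t) l (F t) := by
  induction l generalizing F with
  | nil => exact hF _
  | cons s l ih =>
    exact ih fun x => ((hθ s x).mul (hF _)).add (((isPoly_const 1).sub (hθ s x)).mul (hF _))

theorem exists_common_ne_zero {ι E : Type*} [AddCommGroup E] [Module ℝ E] {S : Set E}
    (hS : Convex ℝ S) (hne : S.Nonempty) (D : ι → E → ℝ)
    (hD : ∀ i θ η, IsPoly fun t => D i (θ + t • (η - θ))) (A : Finset ι)
    (hA : ∀ i ∈ A, ∃ θ ∈ S, D i θ ≠ 0) : ∃ θ ∈ S, ∀ i ∈ A, D i θ ≠ 0 := by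
  induction A using Finset.induction_on with
  | empty => exact ⟨hne.some, hne.some_mem, by simp⟩
  | insert a A ha ih =>
    obtain ⟨θ, hθ, hθA⟩ := ih fun i hi => hA i (Finset.mem_insert_of_mem hi)
    obtain ⟨η, hη, hηa⟩ := hA a (Finset.mem_insert_self _ _)
    choose P hP using fun i => hD i θ η
    have hP0 : ∏ i ∈ insert a A, P i ≠ 0 := by
      refine Finset.prod_ne_zero_iff.2 fun i hi h0 => ?_
      rcases Finset.mem_insert.1 hi with rfl | hi
      · have := hP i 1
        rw [h0] at this
        simp at this
        exact hηa this
      · have := hP i 0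
        rw [h0] at this
        simp at this
        exact hθA i hi this
    obtain ⟨t, ht, htP⟩ := (Set.Icc_infinite (zero_lt_one' ℝ)).exists_notMem_finset
      (∏ i ∈ insert a A, P i).roots.toFinset
    refine ⟨θ + t • (η - θ), hS.add_smul_sub_mem hθ hη ht, fun i hi => ?_⟩
    refine ne_of_eq_of_ne (hP i t) ?_
    rw [Multiset.mem_toFinset, Polynomial.mem_roots hP0, Polynomial.IsRoot,
      Polynomial.eval_prod] at htP
    exact Finset.prod_ne_zero_iff.1 htP i hi

/-- Indicator of the event that `x i` is `true`. -/
noncomputable def lit (i : I) (x : I → Bool) : ℝ := if x i then 1 else 0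

/-- Expectation of `F` on the event that `x` agrees with `t` on `T`. -/
noncomputable def restrictTo (E : ((I → Bool) → ℝ) → ℝ) (T : Set I) (t : I → Bool)
    (F : (I → Bool) → ℝ) : ℝ :=
  E fun x => F x * ev T t x

/-- The covariance, up to normalisation, of `x i` and `x j` on the event that `x` agrees
with `t` on `T`. -/
noncomputable def cov (E : ((I → Bool) → ℝ) → ℝ) (T : Set I) (t : I → Bool) (i j : I) : ℝ :=
  restrictTo E T t (fun x => lit i x * lit j x) * restrictTo E T t (fun _ => 1) -
    restrictTo E T t (lit i) * restrictTo E T t (lit j)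

theorem cov_comm (E : ((I → Bool) → ℝ) → ℝ) (T : Set I) (t : I → Bool) (i j : I) :
    cov E T t i j = cov E T t j i := by
  simp only [cov, mul_comm (lit i _), mul_comm (restrictTo E T t (lit i))]

theorem lit_update_of_ne {i s : I} (h : i ≠ s) (x : I → Bool) (b : Bool) :
    lit i (Function.update x s b) = lit i x := by
  simp [lit, Function.update_of_ne h]

theorem dependsOn_lit (i : I) : DependsOn (lit i) {i} := by
  intro x y hxy
  simp [lit, hxy i rfl]

theorem lit_mem (i : I) (x : I → Bool) : 0 ≤ lit i x ∧ lit i x ≤ 1 := by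
  unfold lit
  split_ifs <;> norm_num

theorem isPoly_cov (l : List I) (T : Set I) (t : I → Bool) (i j : I)
    (θ η : I → (I → Bool) → ℝ) :
    IsPoly fun c : ℝ => cov (expect (θ + c • (η - θ)) l) T t i j := by
  have h : ∀ v x, IsPoly fun c : ℝ => (θ + c • (η - θ)) v x := fun v x =>
    (isPoly_const _).add (IsPoly.mul ⟨.X, fun c => by simp⟩ (isPoly_const _))
  have h' : ∀ F, IsPoly fun c : ℝ => restrictTo (expect (θ + c • (η - θ)) l) T t F := fun F =>
    isPoly_expect h l fun x => isPoly_const _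
  exact ((h' _).mul (h' _)).sub ((h' _).mul (h' _))

theorem restrictTo_linear (θ : I → (I → Bool) → ℝ) (l : List I) (T : Set I) (t : I → Bool)
    (F G K : (I → Bool) → ℝ) (c d e : ℝ) :
    restrictTo (expect θ l) T t (fun x => F x * (c + d * G x + e * K x)) =
      c * restrictTo (expect θ l) T t F + d * restrictTo (expect θ l) T t (fun x => F x * G x) +
        e * restrictTo (expect θ l) T t (fun x => F x * K x) := by
  simp only [restrictTo, ← expect_const_mul, ← expect_add]
  congr 1
  funext x
  ring

theorem restrictTo_cons_of_mem {θ : I → (I → Bool) → ℝ} {l : List I} {s : I} (hs : s ∉ l)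
    {T : Set I} (hsT : s ∈ T) (t : I → Bool) (w : (I → Bool) → ℝ) {F : (I → Bool) → ℝ}
    (hF : ∀ x b, F (Function.update x s b) = F x) :
    restrictTo (expect (Function.update θ s fun x => if t s then w x else 1 - w x) (s :: l)) T t F =
      restrictTo (expect θ l) (T \ {s}) t (fun x => F x * w x) := by
  rw [restrictTo, expect, avg_mul_ev _ _ hsT, expect_update _ hs, restrictTo]
  congr 1
  funext x
  rw [hF, Function.update_self]
  split_ifs <;> ring

theorem restrictTo_cons_of_notMem {θ : I → (I → Bool) → ℝ} {l : List I} {s : I}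
    {T : Set I} (hsT : s ∉ T) (t : I → Bool) {F : (I → Bool) → ℝ} :
    restrictTo (expect θ (s :: l)) T t F = restrictTo (expect θ l) T t (avg θ s F) := by
  rw [restrictTo, expect, avg_mul_of_update_eq θ _ fun x b =>
    update_eq_of_dependsOn (dependsOn_ev T t) hsT x b, restrictTo]

theorem exists_weight {p₀ p₁ p₂ q₀ q₁ q₂ r₀ r₁ r₂ n₀ n₁ n₂ : ℝ} (h₁ : q₁ * n₀ - q₀ * n₁ ≠ 0)
    (h₂ : r₂ * n₀ - n₂ * r₀ ≠ 0) :
    ∃ c d e : ℝ, 0 ≤ c ∧ 0 ≤ d ∧ 0 ≤ e ∧ c + d + e ≤ 1 ∧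
      (c * p₀ + d * p₁ + e * p₂) * (c * n₀ + d * n₁ + e * n₂) -
        (c * q₀ + d * q₁ + e * q₂) * (c * r₀ + d * r₁ + e * r₂) ≠ 0 := by
  by_contra! hcon
  have e00 := hcon 1 0 0 (by norm_num) (by norm_num) (by norm_num) (by norm_num)
  have e11 := hcon 0 1 0 (by norm_num) (by norm_num) (by norm_num) (by norm_num)
  have e22 := hcon 0 0 1 (by norm_num) (by norm_num) (by norm_num) (by norm_num)
  have e01 := hcon (1/2) (1/2) 0 (by norm_num) (by norm_num) (by norm_num) (by norm_num)
  have e02 := hcon (1/2) 0 (1/2) (by norm_num) (by norm_num) (by norm_num) (by norm_num)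
  have e12 := hcon 0 (1/2) (1/2) (by norm_num) (by norm_num) (by norm_num) (by norm_num)
  have f01 : p₀ * n₁ + p₁ * n₀ - q₀ * r₁ - q₁ * r₀ = 0 := by linear_combination 4 * e01 - e00 - e11
  have f02 : p₀ * n₂ + p₂ * n₀ - q₀ * r₂ - q₂ * r₀ = 0 := by linear_combination 4 * e02 - e00 - e22
  have f12 : p₁ * n₂ + p₂ * n₁ - q₁ * r₂ - q₂ * r₁ = 0 := by linear_combination 4 * e12 - e11 - e22
  have f00 : p₀ * n₀ = q₀ * r₀ := by linear_combination e00
  have hn : n₀ ≠ 0 := by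
    rintro rfl
    rcases mul_eq_zero.1 (f00.symm.trans (mul_zero _)) with h | h <;> simp_all
  have a1 : (q₁ * n₀ - q₀ * n₁) * (r₁ * n₀ - r₀ * n₁) = 0 := by
    linear_combination n₀ * n₁ * f01 - n₁ ^ 2 * f00 - n₀ ^ 2 * e11
  have a2 : (q₂ * n₀ - q₀ * n₂) * (r₂ * n₀ - r₀ * n₂) = 0 := by
    linear_combination n₀ * n₂ * f02 - n₂ ^ 2 * f00 - n₀ ^ 2 * e22
  have b1 : r₁ * n₀ - r₀ * n₁ = 0 := (mul_eq_zero.1 a1).resolve_left h₁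
  have b2 : q₂ * n₀ - q₀ * n₂ = 0 := (mul_eq_zero.1 a2).resolve_right (by
    rwa [mul_comm r₀])
  refine mul_ne_zero h₁ h₂ ?_
  linear_combination (-n₀^2) * f12 + n₀*n₂*f01 + n₀*n₁*f02 - 2*n₁*n₂*f00 -
    (q₂ * n₀ - q₀ * n₂) * b1

theorem exists_cov_ne_zero {H : I → I → Prop} {l : List I} (hl : Topological H l) {i j : I}
    {T : Set I} (hi : i ∈ l) (hj : j ∈ l) (hT : ∀ v ∈ T, v ∈ l) (hiT : i ∉ T) (hjT : j ∉ T)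
    {d : Bool} (h : Active (arcsInto H l) T i j d) (t : I → Bool) :
    ∃ θ ∈ networks H, cov (expect θ l) T t i j ≠ 0 := by
  induction l generalizing i j T d with
  | nil => simp at hi
  | cons s l ih =>
    have hS := hl.sinkExtension
    have hs := hl.1
    have mem : ∀ {v}, v ∈ s :: l → v ≠ s → v ∈ l := fun hv hvs =>
      (List.mem_cons.1 hv).resolve_left hvs
    by_cases hsT : s ∈ T
    · have his : i ≠ s := fun h => hiT (h ▸ hsT)
      have hjs : j ≠ s := fun h => hjT (h ▸ hsT)
      have hil := mem hi his
      have hjl := mem hj hjs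
      have hT' : ∀ v ∈ T \ {s}, v ∈ l := fun v hv => mem (hT v hv.1) hv.2
      have nT' : ∀ {v}, v ∉ T → v ∉ T \ {s} := fun hv h => hv h.1
      rcases hS.active_of_mem hsT h his with ⟨-, h | ⟨⟨a, d', ha, haT, h₁⟩, b, hb, h₂⟩⟩ | h
      · obtain ⟨θ, hθ, hc⟩ := ih hl.2.2 hil hjl hT' (nT' hiT) (nT' hjT) h
        refine ⟨Function.update θ s fun x => if t s then 1 else 1 - 1,
          update_mem_networks hθ (fun x y _ => rfl) fun x => by split_ifs <;> norm_num, ?_⟩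
        simp only [cov]
        rw [restrictTo_cons_of_mem hs hsT t (fun _ => 1),
          restrictTo_cons_of_mem hs hsT t (fun _ => 1),
          restrictTo_cons_of_mem hs hsT t (fun _ => 1),
          restrictTo_cons_of_mem hs hsT t (fun _ => 1)]
        · simp only [mul_one]
          exact hc
        all_goals simp [lit_update_of_ne his, lit_update_of_ne hjs]
      · have hbT : b ∉ T \ {s} := fun hbT => nT' hjT ((h₂.eq_of_start_mem hbT).1 ▸ hbT)
        have hal := hl.2.1 a ha
        have hbl := hl.2.1 b hb
        obtain ⟨θ, hθ, hc⟩ := exists_common_ne_zero (convex_networks H) ⟨_, half_mem_networks H⟩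
          (fun k : Bool => fun θ => cov (expect θ l) (T \ {s}) t (if k then i else b)
            (if k then a else j)) (fun k => isPoly_cov l _ t _ _) {true, false} (by
            intro k _
            cases k
            · exact ih hl.2.2 hbl hjl hT' hbT (nT' hjT) h₂
            · exact ih hl.2.2 hil hal hT' (nT' hiT) (nT' haT) h₁)
        have c₁ := hc true (by simp)
        have c₂ := hc false (by simp)
        simp only [if_true, Bool.false_eq_true, if_false, cov] at c₁ c₂
        obtain ⟨c, e, f, hc0, he0, hf0, hsum, hne⟩ := exists_weight
          (p₀ := restrictTo (expect θ l) (T \ {s}) t fun x => lit i x * lit j x)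
          (p₁ := restrictTo (expect θ l) (T \ {s}) t fun x => lit i x * lit j x * lit a x)
          (p₂ := restrictTo (expect θ l) (T \ {s}) t fun x => lit i x * lit j x * lit b x)
          (q₂ := restrictTo (expect θ l) (T \ {s}) t fun x => lit i x * lit b x)
          (r₁ := restrictTo (expect θ l) (T \ {s}) t fun x => lit j x * lit a x)
          c₁ (by simpa only [mul_comm (lit b _)] using c₂)
        have hw : ∀ x, 0 ≤ c + e * lit a x + f * lit b x ∧ c + e * lit a x + f * lit b x ≤ 1 := by
          intro x
          obtain ⟨a0, a1⟩ := lit_mem a x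
          obtain ⟨b0, b1⟩ := lit_mem b x
          constructor
          · positivity
          · nlinarith
        refine ⟨Function.update θ s fun x => if t s then c + e * lit a x + f * lit b x else
          1 - (c + e * lit a x + f * lit b x), update_mem_networks hθ (fun x y hxy => ?_)
          fun x => ?_, ?_⟩
        · simp only [lit, hxy a ha, hxy b hb]
        · have := hw x
          split_ifs
          · exact this
          · constructor <;> linarith
        · simp only [cov]
          rw [restrictTo_cons_of_mem hs hsT t (fun x => c + e * lit a x + f * lit b x),
            restrictTo_cons_of_mem hs hsT t (fun x => c + e * lit a x + f * lit b x),
            restrictTo_cons_of_mem hs hsT t (fun x => c + e * lit a x + f * lit b x),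
            restrictTo_cons_of_mem hs hsT t (fun x => c + e * lit a x + f * lit b x)]
          · simp only [restrictTo_linear]
            simpa only [one_mul] using hne
          all_goals simp [lit_update_of_ne his, lit_update_of_ne hjs]
      · exact absurd h.1 hjs
    · have hT' : ∀ v ∈ T, v ∈ l := fun v hv => mem (hT v hv) (by rintro rfl; exact hsT hv)
      have copy : ∀ a k, H a s → k ≠ s → ∀ θ ∈ networks H, cov (expect θ l) T t a k ≠ 0 →
          ∃ η ∈ networks H, cov (expect η (s :: l)) T t s k ≠ 0 := by
        intro a k ha hk θ hθ hc
        refine ⟨Function.update θ s (lit a), update_mem_networks hθ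
          ((dependsOn_lit a).mono (by simpa using ha)) (lit_mem a), ?_⟩
        have e1 : avg (Function.update θ s (lit a)) s (fun x => lit s x * lit k x) =
            fun x => lit a x * lit k x := by
          funext x
          simp only [avg, Function.update_self, lit_update_of_ne hk]
          simp [lit]
        have e2 : avg (Function.update θ s (lit a)) s (lit s) = lit a := by
          funext x
          simp only [avg, Function.update_self]
          simp [lit]
        have e3 : avg (Function.update θ s (lit a)) s (lit k) = lit k :=
          avg_of_update_eq _ (lit_update_of_ne hk)
        simp only [cov, restrictTo_cons_of_notMem hsT, e1, e2, e3,
          avg_of_update_eq _ (G := fun _ => (1 : ℝ)) fun _ _ => rfl, expect_update _ hs]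
        exact hc
      rcases eq_or_ne i s with rfl | his
      · rcases eq_or_ne j i with rfl | hji
        · refine ⟨_, half_mem_networks H, ?_⟩
          have e1 : avg (fun _ _ => 1 / 2) j (fun x => lit j x * lit j x) = fun _ => 1 / 2 := by
            funext x
            simp [avg, lit]
          have e2 : avg (fun _ _ => 1 / 2) j (lit j) = fun _ => 1 / 2 := by
            funext x
            simp [avg, lit]
          simp only [cov, restrictTo_cons_of_notMem hsT, e1, e2,
            avg_of_update_eq _ (G := fun _ => (1 : ℝ)) fun _ _ => rfl]
          simp only [restrictTo, expect_const_mul, one_mul]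
          have := expect_half_ev_ne_zero T hT' t
          intro h0
          apply this
          rw [← sq_eq_zero_iff]
          simp only [show (fun x => ev T t x) = ev T t from rfl] at h0
          linear_combination 4 * h0
        · rcases hS.active_from_sink hsT h with h | ⟨a, ha, h⟩
          · exact absurd h hji
          · have haT : a ∉ T := fun haT => hjT ((h.eq_of_start_mem haT).1 ▸ haT)
            obtain ⟨θ, hθ, hc⟩ := ih hl.2.2 (hl.2.1 a ha) (mem hj hji) hT' haT hjT h
            exact copy a j ha hji θ hθ hc
      · rcases hS.active_of_notMem hsT h his with ⟨hjs, h⟩ | ⟨rfl, -, a, d', ha, haT, h⟩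
        · obtain ⟨θ, hθ, hc⟩ := ih hl.2.2 (mem hi his) (mem hj hjs) hT' hiT hjT h
          refine ⟨θ, hθ, ?_⟩
          simp only [cov, restrictTo_cons_of_notMem hsT]
          rw [avg_of_update_eq, avg_of_update_eq, avg_of_update_eq, avg_of_update_eq]
          · exact hc
          all_goals simp [lit_update_of_ne his, lit_update_of_ne hjs]
        · obtain ⟨θ, hθ, hc⟩ := ih hl.2.2 (mem hi his) (hl.2.1 a ha) hT' hiT haT h
          obtain ⟨η, hη, hc'⟩ := copy a i ha his θ hθ (by rwa [cov_comm])
          exact ⟨η, hη, by rwa [cov_comm]⟩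

end Model

section Encoding

/-- Every node of `V` carries a copy of the value of its group, except that `y` carries the
random bit `b` and `z` carries the exclusive or of `b` and the value of the group of `y`. -/
noncomputable def encode (π : V → I) (y z : V) (x : I → Bool) (b : Bool) (v : V) : Bool :=
  if v = y then b else if v = z then xor (x (π y)) b else x (π v)

/-- The probability, over a fair bit `b`, that `encode π y z x b` agrees with `a` on `S`. -/
noncomputable def agree (π : V → I) (y z : V) (S : Set V) (a : V → Bool) (x : I → Bool) : ℝ :=
  ∑ b : Bool, if ∀ v ∈ S, encode π y z x b v = a v then 1 / 2 else 0

/-- The distribution of `encode π y z x b` for a fair bit `b` and `x` distributed according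
to the expectation `E`. -/
noncomputable def encoded (E : ((I → Bool) → ℝ) → ℝ) (π : V → I) (y z : V) (f : V → Bool) : ℝ :=
  E (agree π y z Set.univ f)

variable {π : V → I} {y z : V} {r : I → V}

theorem agree_nonneg (S : Set V) (a : V → Bool) (x : I → Bool) : 0 ≤ agree π y z S a x :=
  Finset.sum_nonneg fun b _ => by split_ifs <;> norm_num

theorem agree_empty (a : V → Bool) : agree π y z ∅ a = fun _ => 1 := by
  funext x
  simp [agree]

theorem margin_encoded [Fintype V] [DecidableEq V] (θ : I → (I → Bool) → ℝ) (l : List I)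
    (S : Set V) (a : V → Bool) :
    margin (encoded (expect θ l) π y z) S a = expect θ l (agree π y z S a) := by
  have h : ∀ f : V → Bool, (if ∀ v ∈ S, f v = a v then encoded (expect θ l) π y z f else 0) =
      expect θ l fun x => if ∀ v ∈ S, f v = a v then agree π y z Set.univ f x else 0 := by
    intro f
    split_ifs
    · rfl
    · exact (expect_const θ l 0).symm
  unfold margin
  trans ∑ f : V → Bool, expect θ l fun x =>
    if ∀ v ∈ S, f v = a v then agree π y z Set.univ f x else 0
  · exact Finset.sum_congr rfl fun f _ => by convert h f
  rw [← expect_sum]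
  congr 1
  funext x
  simp only [agree]
  rw [Finset.sum_congr rfl fun f _ => show _ = ∑ b : Bool, if encode π y z x b = f then
    (if ∀ v ∈ S, encode π y z x b v = a v then (1 / 2 : ℝ) else 0) else 0 from ?_]
  · rw [Finset.sum_comm]
    exact Finset.sum_congr rfl fun b _ => by rw [Finset.sum_ite_eq]; simp
  · trans ∑ b : Bool, if ∀ v ∈ S, f v = a v then
      (if ∀ v ∈ Set.univ, encode π y z x b v = f v then (1 / 2 : ℝ) else 0) else 0
    · split_ifs <;> simp
    refine Finset.sum_congr rfl fun b _ => ?_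
    have hf : (∀ v ∈ Set.univ, encode π y z x b v = f v) ↔ encode π y z x b = f := by
      simp [funext_iff]
    simp only [hf]
    by_cases h' : encode π y z x b = f
    · subst h'
      simp
    · simp [h']

theorem isDist_encoded [Fintype V] [DecidableEq V] {H : I → I → Prop}
    {θ : I → (I → Bool) → ℝ} (hθ : θ ∈ networks H) (l : List I) :
    IsDist (encoded (expect θ l) π y z) := by
  refine ⟨fun f => expect_nonneg hθ l (agree_nonneg _ _), ?_⟩
  have := margin_encoded (π := π) (y := y) (z := z) θ l ∅ fun _ => true
  rw [agree_empty, expect_const] at this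
  simpa [margin] using this

theorem dependsOn_agree (hyz : y ≠ z) (X : Set I) (a : V → Bool) :
    DependsOn (agree π y z (π ⁻¹' X) a) X := by
  intro x x' hxx
  by_cases hy : x (π y) = x' (π y)
  · refine Finset.sum_congr rfl fun b _ => ?_
    congr 1
    refine propext (forall₂_congr fun v hv => ?_)
    simp only [encode, hy, hxx _ hv]
  · refine Fintype.sum_equiv Equiv.boolNot _ _ fun b => ?_
    congr 1
    refine propext (forall₂_congr fun v hv => ?_)
    have hvy : v ≠ y := by
      rintro rfl
      exact hy (hxx _ hv)
    simp only [encode, hvy, if_false, hxx _ hv, Equiv.boolNot_apply]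
    rw [show x' (π y) = !x (π y) by revert hy; cases x (π y) <;> cases x' (π y) <;> simp]
    simp

theorem agree_mul_ev (hr : ∀ k, π (r k) = k ∧ r k ≠ y ∧ r k ≠ z) {S : Set V} {X : Set I}
    (hX : π ⁻¹' X ⊆ S) (a : V → Bool) (x : I → Bool) :
    agree π y z S a x * ev X (fun k => a (r k)) x = agree π y z S a x := by
  by_cases h : ∀ k ∈ X, x k = a (r k)
  · rw [ev, if_pos h, mul_one]
  · rw [ev, if_neg h, mul_zero, agree, Finset.sum_eq_zero]
    intro b _
    refine if_neg fun hS => h fun k hk => ?_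
    have := hS (r k) (hX (by simpa [(hr k).1] using hk))
    simpa [encode, hr k] using this

theorem agree_union {j : I} (hy : π y ≠ j) (hz : π z ≠ j) (S : Set V) (a : V → Bool)
    (x : I → Bool) :
    agree π y z (π ⁻¹' {j} ∪ S) a x = agree π y z S a x * agree π y z (π ⁻¹' {j}) a x := by
  have h : ∀ b, (∀ v ∈ π ⁻¹' {j}, encode π y z x b v = a v) ↔ ∀ v ∈ π ⁻¹' {j}, x j = a v := by
    intro b
    refine forall₂_congr fun v hv => ?_
    have hvj : π v = j := hv
    have h1 : v ≠ y := by rintro rfl; exact hy hv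
    have h2 : v ≠ z := by rintro rfl; exact hz hv
    simp [encode, h1, h2, hvj]
  simp only [agree, Set.mem_union, or_imp, forall_and, h]
  generalize (∀ v ∈ π ⁻¹' {j}, x j = a v) = P
  by_cases hP : P
  · simp [hP, ← two_mul]
  · simp [hP]

theorem CondIndep.symm [Fintype V] [DecidableEq V] {p : (V → Bool) → ℝ} {X Y Z : Set V}
    (h : CondIndep p X Y Z) : CondIndep p Y X Z := by
  intro a ha
  rw [Set.union_comm Y X, h a ha, mul_comm]

theorem condIndep_encoded_of_exchange [Fintype V] [DecidableEq V] {θ : I → (I → Bool) → ℝ}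
    {l : List I} (hr : ∀ k, π (r k) = k ∧ r k ≠ y ∧ r k ≠ z) (hyz : y ≠ z) {i j : I} {T : Set I}
    (hy : π y ≠ j) (hz : π z ≠ j) (h : Exchange (expect θ l) {i} {j} T) :
    CondIndep (encoded (expect θ l) π y z) (π ⁻¹' {i}) (π ⁻¹' {j}) (π ⁻¹' T) := by
  intro a _
  rw [Set.union_comm (π ⁻¹' {i}) (π ⁻¹' {j}), Set.union_assoc]
  simp only [margin_encoded]
  have key := h (fun k => a (r k)) (agree π y z (π ⁻¹' {i} ∪ π ⁻¹' T) a) (agree π y z (π ⁻¹' T) a)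
    (agree π y z (π ⁻¹' {j}) a) (fun _ => 1) (by
      rw [← Set.preimage_union]
      exact dependsOn_agree hyz _ a)
    ((dependsOn_agree hyz T a).mono Set.subset_union_right)
    ((dependsOn_agree hyz {j} a).mono Set.subset_union_left) (fun _ _ _ => rfl)
  simp only [mul_one, mul_right_comm _ (agree π y z (π ⁻¹' {j}) a _),
    agree_mul_ev hr Set.subset_union_right, agree_mul_ev hr subset_rfl] at key
  simpa only [← agree_union hy hz] using key

theorem agree_eq_ev_mul (hr : ∀ k, π (r k) = k ∧ r k ≠ y ∧ r k ≠ z) (hyz : y ≠ z) (X : Set I)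
    {a : V → Bool} {t : I → Bool} (ha : ∀ k, a (r k) = t k) (x : I → Bool) :
    agree π y z (π ⁻¹' X) a x = agree π y z (π ⁻¹' X) a t * ev X t x := by
  rw [← agree_mul_ev hr subset_rfl, show (fun k => a (r k)) = t from funext ha]
  by_cases h : ∀ k ∈ X, x k = t k
  · rw [dependsOn_agree hyz X a h]
  · rw [ev, if_neg h, mul_zero, mul_zero]

theorem agree_pos {S : Set V} {a : V → Bool} {x : I → Bool} (b : Bool)
    (h : ∀ v ∈ S, encode π y z x b v = a v) : 0 < agree π y z S a x := by
  refine Finset.sum_pos' (fun b _ => by split_ifs <;> norm_num) ⟨b, Finset.mem_univ _, ?_⟩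
  rw [if_pos h]
  norm_num

theorem ev_singleton_union (i : I) (T : Set I) :
    ev ({i} ∪ T) (fun _ => true) = fun x => lit i x * ev T (fun _ => true) x := by
  funext x
  simp only [ev, lit, Set.mem_union, Set.mem_singleton_iff, or_imp, forall_and, forall_eq]
  by_cases h : x i = true <;> simp [h]

theorem cov_eq_zero_of_condIndep [Fintype V] [DecidableEq V] {H : I → I → Prop}
    {θ : I → (I → Bool) → ℝ} (hθ : θ ∈ networks H)
    {l : List I} (hr : ∀ k, π (r k) = k ∧ r k ≠ y ∧ r k ≠ z) (hyz : y ≠ z) {i j : I} {T : Set I}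
    (hy : π y ≠ j) (hz : π z ≠ j)
    (h : CondIndep (encoded (expect θ l) π y z) (π ⁻¹' {i}) (π ⁻¹' {j}) (π ⁻¹' T)) :
    cov (expect θ l) T (fun _ => true) i j = 0 := by
  set t : I → Bool := fun _ => true with ht
  set a := encode π y z t true with ha
  have har : ∀ k, a (r k) = t k := fun k => by simp [ha, encode, hr k]
  have hpos : ∀ S : Set V, 0 < agree π y z S a t := fun S => agree_pos true fun _ _ => rfl
  have hone : agree π y z (π ⁻¹' {j}) a t ≠ 0 := (hpos _).ne'
  have hm : ∀ X : Set I, margin (encoded (expect θ l) π y z) (π ⁻¹' X) a =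
      agree π y z (π ⁻¹' X) a t * expect θ l (ev X t) := fun X => by
    rw [margin_encoded, ← expect_const_mul]
    congr 1
    funext x
    exact agree_eq_ev_mul hr hyz X har x
  have h0 : 0 ≤ expect θ l (ev T t) := expect_nonneg hθ l fun x => by
    unfold ev; split_ifs <;> norm_num
  have e1 : expect θ l (ev T t) = restrictTo (expect θ l) T t fun _ => 1 := by
    simp only [restrictTo, one_mul]
  have e2 : ∀ k, expect θ l (ev ({k} ∪ T) t) = restrictTo (expect θ l) T t (lit k) := fun k => by
    rw [ev_singleton_union, restrictTo]
  have e3 : expect θ l (ev ({j} ∪ ({i} ∪ T)) t) =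
      restrictTo (expect θ l) T t fun x => lit i x * lit j x := by
    rw [ev_singleton_union, ev_singleton_union, restrictTo]
    congr 1
    funext x
    ring
  rcases h0.eq_or_lt with h0 | h0
  · have hle : ∀ k, expect θ l (ev ({k} ∪ T) t) = 0 := fun k => by
      refine le_antisymm ?_ (expect_nonneg hθ l fun x => by unfold ev; split_ifs <;> norm_num)
      have : 0 ≤ expect θ l fun x => ev T t x + -1 * ev ({k} ∪ T) t x := by
        refine expect_nonneg hθ l fun x => ?_
        rw [ev_singleton_union]
        have h1 := lit_mem k x
        have h2 : 0 ≤ ev T t x := by unfold ev; split_ifs <;> norm_num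
        show 0 ≤ ev T t x + -1 * (lit k x * ev T t x)
        nlinarith
      rw [expect_add, expect_const_mul, ← h0] at this
      linarith
    rw [cov, ← e1, ← h0, ← e2, hle]
    ring
  · have hci := h a (by rw [hm]; exact mul_pos (hpos _) h0)
    rw [Set.union_comm (π ⁻¹' {i}) (π ⁻¹' {j}), Set.union_assoc] at hci
    simp only [← Set.preimage_union, hm, e1, e2, e3] at hci
    simp only [Set.preimage_union, agree_union hy hz] at hci
    have hc1 := (hpos (π ⁻¹' {i} ∪ π ⁻¹' T)).ne'
    have hc2 := (hpos (π ⁻¹' T)).ne'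
    rw [cov]
    refine mul_left_cancel₀ (mul_ne_zero (mul_ne_zero hc1 hc2) hone) ?_
    linear_combination hci

theorem restrictTo_pos_of_cov_self {H : I → I → Prop} {θ : I → (I → Bool) → ℝ}
    (hθ : θ ∈ networks H) {l : List I} {T : Set I} {t : I → Bool} {i : I}
    (h : cov (expect θ l) T t i i ≠ 0) :
    0 < restrictTo (expect θ l) T t (lit i) ∧
      restrictTo (expect θ l) T t (lit i) < restrictTo (expect θ l) T t fun _ => 1 := by
  have hev : ∀ x, 0 ≤ ev T t x := fun x => by unfold ev; split_ifs <;> norm_num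
  have hsq : (fun x => lit i x * lit i x) = lit i := by
    funext x
    simp [lit]
  rw [cov, hsq, ← mul_sub] at h
  have h1 : 0 ≤ restrictTo (expect θ l) T t (lit i) :=
    expect_nonneg hθ l fun x => mul_nonneg (lit_mem i x).1 (hev x)
  have h2 : 0 ≤ restrictTo (expect θ l) T t fun x => 1 * (1 + -1 * lit i x + 0 * lit i x) :=
    expect_nonneg hθ l fun x => mul_nonneg (by linarith [(lit_mem i x).2]) (hev x)
  rw [restrictTo_linear] at h2
  simp only [one_mul, zero_mul, add_zero] at h2
  have h3 := h1.lt_of_ne' (left_ne_zero_of_mul h)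
  have h4 := right_ne_zero_of_mul h
  exact ⟨h3, lt_of_le_of_ne (by linarith) fun h => h4 (by rw [h]; ring)⟩

theorem not_condIndep_encoded_of_split [Fintype V] [DecidableEq V] {H : I → I → Prop}
    {θ : I → (I → Bool) → ℝ} (hθ : θ ∈ networks H) {l : List I}
    (hr : ∀ k, π (r k) = k ∧ r k ≠ y ∧ r k ≠ z) (hyz : π y ≠ π z) {T : Set I}
    (hyT : π y ∉ T) (hzT : π z ∉ T)
    (hy : cov (expect θ l) T (fun _ => true) (π y) (π y) ≠ 0)
    (hz : cov (expect θ l) T (fun _ => true) (π z) (π z) ≠ 0) :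
    ¬ CondIndep (encoded (expect θ l) π y z) (π ⁻¹' {π y}) (π ⁻¹' {π z}) (π ⁻¹' T) := by
  intro h
  have hyz' : y ≠ z := fun h => hyz (h ▸ rfl)
  set t : I → Bool := fun _ => true with ht
  have hm : ∀ X : Set I, margin (encoded (expect θ l) π y z) (π ⁻¹' X) (fun _ => true) =
      agree π y z (π ⁻¹' X) (fun _ => true) t * expect θ l (ev X t) := fun X => by
    rw [margin_encoded, ← expect_const_mul]
    congr 1
    funext x
    exact agree_eq_ev_mul hr hyz' X (fun _ => rfl) x
  have pz : ∀ X : Set I, π z ∉ X → 0 < agree π y z (π ⁻¹' X) (fun _ => true) t := fun X hX =>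
    agree_pos true fun v hv => by
      have : v ≠ z := by rintro rfl; exact hX hv
      simp [encode, this, ht]
  have py : ∀ X : Set I, π y ∉ X → 0 < agree π y z (π ⁻¹' X) (fun _ => true) t := fun X hX =>
    agree_pos false fun v hv => by
      have : v ≠ y := by rintro rfl; exact hX hv
      simp [encode, this, ht]
  have e1 : expect θ l (ev T t) = restrictTo (expect θ l) T t fun _ => 1 := by
    simp only [restrictTo, one_mul]
  have e2 : ∀ k, expect θ l (ev ({k} ∪ T) t) = restrictTo (expect θ l) T t (lit k) := fun k => by
    rw [ev_singleton_union, restrictTo]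
  obtain ⟨y1, y2⟩ := restrictTo_pos_of_cov_self hθ hy
  obtain ⟨z1, -⟩ := restrictTo_pos_of_cov_self hθ hz
  have h0 : agree π y z (π ⁻¹' ({π y} ∪ {π z} ∪ T)) (fun _ => true) t = 0 := by
    refine Finset.sum_eq_zero fun b _ => if_neg fun hall => ?_
    have a1 := hall y (by simp)
    have a2 := hall z (by simp)
    simp [encode, hyz'.symm, ht] at a1 a2
    simp [a1] at a2
  have hci := h (fun _ => true) (by rw [hm, e1]; exact mul_pos (pz _ hzT) (y1.trans y2))
  simp only [← Set.preimage_union, hm, h0, e2, zero_mul] at hci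
  exact (mul_pos (mul_pos (pz ({π y} ∪ T) (by simp [hzT, hyz.symm])) y1)
    (mul_pos (py ({π z} ∪ T) (by simp [hyT, hyz])) z1)).ne hci

theorem not_faithful_encoded [Fintype V] [DecidableEq V] {H : I → I → Prop}
    {θ : I → (I → Bool) → ℝ} (hθ : θ ∈ networks H) {l : List I}
    (hr : ∀ k, π (r k) = k ∧ r k ≠ y ∧ r k ≠ z) (hyz : y ≠ z)
    (hy : cov (expect θ l) ∅ (fun _ => true) (π y) (π y) ≠ 0) (G : V → V → Prop) :
    ¬ Faithful (encoded (expect θ l) π y z) G := by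
  intro hF
  obtain ⟨hrπ, hry, hrz⟩ := hr (π y)
  have hx : ∀ a : V → Bool, agree π y z {r (π y)} a =
      fun x => if x (π y) = a (r (π y)) then 1 else 0 := by
    intro a
    funext x
    simp [agree, encode, hry, hrz, hrπ]
  have c1 : CondIndep (encoded (expect θ l) π y z) {r (π y)} {y} ∅ := by
    intro a _
    have h1 : agree π y z {y} a = fun _ => 1 / 2 := by
      funext x
      cases hb : a y <;> simp [agree, encode, hb]
    have h2 : agree π y z ({r (π y)} ∪ {y}) a =
        fun x => 1 / 2 * if x (π y) = a (r (π y)) then 1 else 0 := by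
      funext x
      cases hb : a y <;> simp [agree, encode, hb, hry, hrz, hrπ]
    simp only [Set.union_empty, margin_encoded, agree_empty, expect_const, hx, h1, h2,
      expect_const_mul]
    ring
  have c2 : CondIndep (encoded (expect θ l) π y z) {r (π y)} {z} ∅ := by
    intro a _
    have h1 : agree π y z {z} a = fun _ => 1 / 2 := by
      funext x
      cases hb : a z <;> cases hc : x (π y) <;> simp [agree, encode, hb, hc, hyz.symm]
    have h2 : agree π y z ({r (π y)} ∪ {z}) a =
        fun x => 1 / 2 * if x (π y) = a (r (π y)) then 1 else 0 := by
      funext x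
      cases hb : a z <;> cases hc : x (π y) <;>
        simp [agree, encode, hb, hc, hry, hrz, hrπ, hyz.symm]
    simp only [Set.union_empty, margin_encoded, agree_empty, expect_const, hx, h1, h2,
      expect_const_mul]
    ring
  have d1 := (hF {r (π y)} {y} ∅ (by simp) (by simp) (by simpa) (by simp) (by simp)).1 c1
  have d2 := (hF {r (π y)} {z} ∅ (by simp) (by simp) (by simpa) (by simp) (by simp)).1 c2
  have c3 := (hF {r (π y)} {y, z} ∅ (by simp) (by simp) (by simp [hry, hrz]) (by simp)
    (by simp)).2 (by
      rintro u hu v (rfl | rfl)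
      exacts [d1 u hu _ rfl, d2 u hu _ rfl])
  have h1 : agree π y z {y, z} (fun _ => true) = fun x => 1 / 2 * (1 + -1 * lit (π y) x) := by
    funext x
    cases hc : x (π y) <;> simp [agree, encode, hc, hyz.symm, lit]
  have h2 : agree π y z ({r (π y)} ∪ {y, z}) (fun _ => true) = fun _ => 0 := by
    funext x
    cases hc : x (π y) <;> simp [agree, encode, hc, hyz.symm, hry, hrz, hrπ]
  have hci := c3 (fun _ => true) (by
    rw [margin_encoded, agree_empty, expect_const]; exact one_pos)
  have h3 : ∀ F, restrictTo (expect θ l) ∅ (fun _ => true) F = expect θ l F := fun F => by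
    simp [restrictTo, ev]
  obtain ⟨p1, p2⟩ := restrictTo_pos_of_cov_self hθ hy
  rw [h3] at p1 p2
  rw [h3, expect_const] at p2
  simp only [Set.union_empty, margin_encoded, h1, h2, hx, expect_const, expect_const_mul,
    expect_add] at hci
  have h4 : (expect θ l fun x => if x (π y) = true then 1 else 0) = expect θ l (lit (π y)) := by
    congr 1
  rw [h4] at hci
  nlinarith [mul_pos p1 (sub_pos.2 p2)]

end Encoding

theorem exists_pad_nodes [Finite V] (π : V → I) (hπ : Function.Surjective π)
    (H : I → I → Prop)
    (hsize : (∃ i : I, 3 ≤ (π ⁻¹' {i}).ncard) ∨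
      ((∀ i : I, (π ⁻¹' {i}).ncard ≤ 2) ∧
        ∃ i j : I, i ≠ j ∧ (π ⁻¹' {i}).ncard = 2 ∧ (π ⁻¹' {j}).ncard = 2 ∧ Adj H i j)) :
    ∃ y z : V, y ≠ z ∧ (π y = π z ∨ Adj H (π y) (π z)) ∧
      ∃ r : I → V, ∀ k, π (r k) = k ∧ r k ≠ y ∧ r k ≠ z := by
  rcases hsize with ⟨i, hi⟩ | ⟨-, i, j, hij, hi, hj, hadj⟩
  · obtain ⟨x, hx, y, hy, z, hz, hxy, hxz, hyz⟩ :=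
      (Set.two_lt_ncard (Set.toFinite _)).1 hi
    have m : ∀ {v}, v ∈ π ⁻¹' {i} → π v = i := fun h => h
    refine ⟨y, z, hyz, .inl ((m hy).trans (m hz).symm), ?_⟩
    refine Classical.axiomOfChoice (r := fun k v => π v = k ∧ v ≠ y ∧ v ≠ z) fun k => ?_
    rcases eq_or_ne k i with rfl | hki
    · exact ⟨x, m hx, hxy, hxz⟩
    · obtain ⟨v, rfl⟩ := hπ k
      refine ⟨v, rfl, ?_, ?_⟩
      · rintro rfl; exact hki (m hy)
      · rintro rfl; exact hki (m hz)
  · obtain ⟨y, y', hyy, hy⟩ := Set.ncard_eq_two.1 hi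
    obtain ⟨z, z', hzz, hz⟩ := Set.ncard_eq_two.1 hj
    have m : ∀ {v k}, v ∈ π ⁻¹' {k} → π v = k := fun h => h
    have y1 : π y = i := m (hy ▸ by simp)
    have y2 : π y' = i := m (hy ▸ by simp)
    have z1 : π z = j := m (hz ▸ by simp)
    have z2 : π z' = j := m (hz ▸ by simp)
    refine ⟨y, z, ?_, .inr (by rwa [y1, z1]), ?_⟩
    · rintro rfl
      exact hij (y1.symm.trans z1)
    · refine Classical.axiomOfChoice (r := fun k v => π v = k ∧ v ≠ y ∧ v ≠ z) fun k => ?_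
      rcases eq_or_ne k i with rfl | hki
      · refine ⟨y', y2, hyy.symm, ?_⟩
        rintro rfl
        exact hij (y2.symm.trans z1)
      · rcases eq_or_ne k j with rfl | hkj
        · refine ⟨z', z2, ?_, hzz.symm⟩
          rintro rfl
          exact hij (y1.symm.trans z2)
        · obtain ⟨v, rfl⟩ := hπ k
          refine ⟨v, rfl, ?_, ?_⟩
          · rintro rfl; exact hki y1
          · rintro rfl; exact hkj z1

theorem exists_cov_ne_zero_of_active [Finite I] {H : I → I → Prop} {l : List I}
    (hl : Topological H l) (hmem : ∀ v, v ∈ l) :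
    ∃ θ ∈ networks H, ∀ (i j : I) (T : Set I), i ∉ T → j ∉ T → (∃ d, Active H T i j d) →
      cov (expect θ l) T (fun _ => true) i j ≠ 0 := by
  have := Fintype.ofFinite I
  have harcs : arcsInto H l = H := by
    funext u v
    simp [arcsInto, hmem]
  obtain ⟨θ, hθ, h⟩ := exists_common_ne_zero (convex_networks H) ⟨_, half_mem_networks H⟩
    (fun c : I × I × Set I => fun θ => cov (expect θ l) c.2.2 (fun _ => true) c.1 c.2.1)
    (fun c => isPoly_cov l _ _ _ _)
    (Finset.univ.filter fun c : I × I × Set I => c.1 ∉ c.2.2 ∧ c.2.1 ∉ c.2.2 ∧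
      ∃ d, Active H c.2.2 c.1 c.2.1 d) (by
      rintro ⟨i, j, T⟩ hc
      obtain ⟨hi, hj, d, hA⟩ := (Finset.mem_filter.1 hc).2
      exact exists_cov_ne_zero hl (hmem i) (hmem j) (fun v _ => hmem v) hi hj
        (harcs.symm ▸ hA) _)
  exact ⟨θ, hθ, fun i j T hi hj hA =>
    h (i, j, T) (Finset.mem_filter.2 ⟨Finset.mem_univ _, hi, hj, hA⟩)⟩

/-- Theorem 2 of the paper. If some group has size at least 3, or
the maximum group size is 2 and two groups of size 2 are adjacent in the group DAG
`H`, then there is a (binary-valued) distribution that is groupwise faithful to `H`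
given the grouping but is not faithful to any DAG on the variables. -/
theorem exists_groupwise_faithful_not_faithful
    {V I : Type*} [Fintype V] [Fintype I] [DecidableEq V]
    (π : V → I) (hπ : Function.Surjective π)
    (H : I → I → Prop) (hH : IsDAG H)
    (hsize : (∃ i : I, 3 ≤ (π ⁻¹' {i}).ncard) ∨
      ((∀ i : I, (π ⁻¹' {i}).ncard ≤ 2) ∧
        ∃ i j : I, i ≠ j ∧ (π ⁻¹' {i}).ncard = 2 ∧ (π ⁻¹' {j}).ncard = 2 ∧ Adj H i j)) :
    ∃ p : (∀ _ : V, Bool) → ℝ, IsDist p ∧ GroupwiseFaithful p π H ∧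
      ∀ G : V → V → Prop, IsDAG G → ¬ Faithful p G := by
  obtain ⟨y, z, hyz, hadj, r, hr⟩ := exists_pad_nodes π hπ H hsize
  obtain ⟨l, hl, hmem⟩ := exists_topological hH
  obtain ⟨θ, hθ, hcov⟩ := exists_cov_ne_zero_of_active hl hmem
  have harcs : arcsInto H l = H := by
    funext u v
    simp [arcsInto, hmem]
  refine ⟨encoded (expect θ l) π y z, isDist_encoded hθ l, ?_, fun G _ =>
    not_faithful_encoded hθ hr hyz (hcov _ _ ∅ (by simp) (by simp) ⟨_, .start⟩) G⟩
  intro i j hij T hi hj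
  have split : (π y ≠ j ∧ π z ≠ j) ∨ (π y ≠ i ∧ π z ≠ i) ∨ (π y = i ∧ π z = j) ∨
      (π y = j ∧ π z = i) := by grind
  constructor
  · intro hci hconn
    have hne := hcov i j T hi hj (hconn.active hH hi)
    rcases split with ⟨h1, h2⟩ | ⟨h1, h2⟩ | ⟨rfl, rfl⟩ | ⟨rfl, rfl⟩
    · exact hne (cov_eq_zero_of_condIndep hθ hr hyz h1 h2 hci)
    · exact hne ((cov_comm _ _ _ _ _).trans
        (cov_eq_zero_of_condIndep hθ hr hyz h1 h2 hci.symm))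
    · exact not_condIndep_encoded_of_split hθ hr hij hi hj (hcov _ _ T hi hi ⟨_, .start⟩)
        (hcov _ _ T hj hj ⟨_, .start⟩) hci
    · exact not_condIndep_encoded_of_split hθ hr hij.symm hj hi (hcov _ _ T hj hj ⟨_, .start⟩)
        (hcov _ _ T hi hi ⟨_, .start⟩) hci.symm
  · intro hsep
    have hex : Exchange (expect θ l) {i} {j} T := by
      refine exchange_of_not_active hθ.1 hl (by simpa) (by simpa) ?_
      rintro _ rfl _ rfl d hA
      exact hsep ((harcs ▸ hA).dconn hH hi hij)
    rcases split with ⟨h1, h2⟩ | ⟨h1, h2⟩ | ⟨rfl, rfl⟩ | ⟨rfl, rfl⟩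
    · exact condIndep_encoded_of_exchange hr hyz h1 h2 hex
    · exact (condIndep_encoded_of_exchange hr hyz h1 h2 hex.symm).symm
    · exact absurd ((hadj.resolve_left hij).dconn hij T) hsep
    · exact absurd (Adj.dconn (Or.symm (hadj.resolve_left hij.symm)) hij T) hsep

end GroupBN
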